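/- For every orbit Ω ∈ K^n/ℤ^n and every 𝒟_Ω ⊆ 𝔻_Ω, every module in GW(𝕀_n, 𝒟_Ω) (and every weight module therein) is equidimensional, and the length of the module equals the dimension of any of its (generalized) weight components. In particular, every indecomposable generalized weight 𝕀_n-module is equidimensional. -/

import Mathlib

set_option maxHeartbeats 1000000
set_option synthInstance.maxHeartbeats 400000
set_option linter.unusedSectionVars false

namespace IDO

open scoped TensorProduct

noncomputable section

variable (K : Type*) [Field K] [CharZero K] (n : ℕ)

/-- The polynomial algebra `P_n = K[x_1, …, x_n]`. -/
abbrev P := MvPolynomial (Fin n) K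

/-- The multiplication operator `x_i`. -/
def xOp (i : Fin n) : Module.End K (P K n) := LinearMap.mulLeft K (MvPolynomial.X i)

/-- The partial derivative `∂_i`. -/
def dOp (i : Fin n) : Module.End K (P K n) := (MvPolynomial.pderiv i).toLinearMap

/-- The integration operator `∫_i`, sending `x^α ↦ x^{α+e_i}/(α_i+1)`. -/
def intOp (i : Fin n) : Module.End K (P K n) :=
  ((MvPolynomial.basisMonomials (Fin n) K).constr K)
    (fun α => (((α i : ℕ) : K) + 1)⁻¹ •
      (MvPolynomial.monomial (α + Finsupp.single i 1) (1 : K)))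

/-- The algebra of polynomial integro-differential operators `𝕀_n`, as a subalgebra of
`End_K(P_n)` generated by the `x_i`, `∂_i` and `∫_i`. -/
def InSub : Subalgebra K (Module.End K (P K n)) :=
  Algebra.adjoin K (Set.range (xOp K n) ∪ Set.range (dOp K n) ∪ Set.range (intOp K n))

/-- The algebra `𝕀_n` (as a type, with its canonical ring structure). -/
def In : Type _ := InSub K n

instance : Ring (In K n) := inferInstanceAs (Ring (InSub K n))
instance : Algebra K (In K n) := inferInstanceAs (Algebra K (InSub K n))
instance : Module (In K n) (P K n) := inferInstanceAs (Module (InSub K n) (P K n))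
instance : IsScalarTower K (In K n) (P K n) :=
  inferInstanceAs (IsScalarTower K (InSub K n) (P K n))

/-- `x_i` as an element of `𝕀_n`. -/
def xEl (i : Fin n) : In K n :=
  show InSub K n from
    ⟨xOp K n i, Algebra.subset_adjoin (Set.mem_union_left _ (Set.mem_union_left _ ⟨i, rfl⟩))⟩

/-- `∂_i` as an element of `𝕀_n`. -/
def dEl (i : Fin n) : In K n :=
  show InSub K n from
    ⟨dOp K n i, Algebra.subset_adjoin (Set.mem_union_left _ (Set.mem_union_right _ ⟨i, rfl⟩))⟩

/-- `∫_i` as an element of `𝕀_n`. -/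
def intEl (i : Fin n) : In K n :=
  show InSub K n from
    ⟨intOp K n i, Algebra.subset_adjoin (Set.mem_union_right _ ⟨i, rfl⟩)⟩

/-- `H_i = ∂_i x_i` as an element of `𝕀_n`. -/
def HEl (i : Fin n) : In K n := dEl K n i * xEl K n i

section Modules

variable (M : Type*) [AddCommGroup M] [Module K M] [Module (In K n) M]
  [IsScalarTower K (In K n) M]

/-- The weight space `M_λ = {m | H_i m = λ_i m for all i}`. -/
def weightSpace (lam : Fin n → K) : Submodule K M where
  carrier := {m | ∀ i, HEl K n i • m = lam i • m}
  add_mem' := by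
    intro a b ha hb i
    rw [smul_add, ha i, hb i, smul_add]
  zero_mem' := by intro i; simp
  smul_mem' := by
    intro c m hm i
    rw [← smul_comm c (HEl K n i) m, hm i, smul_smul, mul_comm, ← smul_smul]

private lemma pow_smul_zero_mono {a : In K n} {m : M} {s s' : ℕ}
    (h : (a ^ s) • m = 0) (hle : s ≤ s') : (a ^ s') • m = 0 := by
  obtain ⟨k, rfl⟩ := Nat.exists_eq_add_of_le hle
  rw [add_comm s k, pow_add, mul_smul, h, smul_zero]

/-- The generalized weight space `M^λ = {m | (H_i − λ_i)^N m = 0 for some N and all i}`. -/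
def genWeightSpace (lam : Fin n → K) : Submodule K M where
  carrier := {m | ∃ N : ℕ, ∀ i,
    ((HEl K n i - algebraMap K (In K n) (lam i)) ^ N) • m = 0}
  add_mem' := by
    rintro a b ⟨Na, ha⟩ ⟨Nb, hb⟩
    refine ⟨Na ⊔ Nb, fun i => ?_⟩
    rw [smul_add, pow_smul_zero_mono K n M (ha i) le_sup_left,
      pow_smul_zero_mono K n M (hb i) le_sup_right, add_zero]
  zero_mem' := ⟨0, fun i => smul_zero _⟩
  smul_mem' := by
    rintro c m ⟨N, hN⟩
    exact ⟨N, fun i => by rw [← smul_comm c _ m, hN i, smul_zero]⟩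

/-- `M` is a weight module: `M = ⊕_λ M_λ`. -/
def IsWeightModule : Prop :=
  letI := Classical.decEq (Fin n → K)
  DirectSum.IsInternal (fun lam : Fin n → K => weightSpace K n M lam)

/-- `M` is a generalized weight module: `M = ⊕_λ M^λ`. -/
def IsGenWeightModule : Prop :=
  letI := Classical.decEq (Fin n → K)
  DirectSum.IsInternal (fun lam : Fin n → K => genWeightSpace K n M lam)

/-- The support `Supp(M) = {λ | M^λ ≠ 0}`. -/
def supp : Set (Fin n → K) := {lam | genWeightSpace K n M lam ≠ ⊥}

/-- `M` is an indecomposable `𝕀_n`-module. -/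
def IsIndecomposableMod : Prop :=
  Nontrivial M ∧ ∀ p q : Submodule (In K n) M, IsCompl p q → p = ⊥ ∨ q = ⊥

/-- The annihilator of an `𝕀_n`-module, as a set. -/
def annSet : Set (In K n) := {a | ∀ m : M, a • m = 0}

end Modules

/-- A prime (two-sided) ideal of the noncommutative ring `𝕀_n`, given as a set:
`S ≠ 𝕀_n` and `a 𝕀_n b ⊆ S → a ∈ S ∨ b ∈ S`. -/
def IsPrimeSet (S : Set (In K n)) : Prop :=
  S ≠ Set.univ ∧ ∀ a b : In K n, (∀ r : In K n, a * r * b ∈ S) → a ∈ S ∨ b ∈ S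

-- orbits
/-- The `ℤ^n`-orbit of `λ ∈ K^n`. -/
def orbitOf (lam : Fin n → K) : Set (Fin n → K) :=
  {mu | ∀ i, ∃ z : ℤ, mu i - lam i = (z : K)}

/-- The setoid on `K^n` whose classes are the `ℤ^n`-orbits. -/
def orbitSetoid : Setoid (Fin n → K) where
  r mu nu := ∀ i, ∃ z : ℤ, mu i - nu i = (z : K)
  iseqv := by
    constructor
    · intro x i; exact ⟨0, by simp⟩
    · intro x y h i
      obtain ⟨z, hz⟩ := h i
      exact ⟨-z, by push_cast; linear_combination -hz⟩
    · intro x y z hxy hyz i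
      obtain ⟨a, ha⟩ := hxy i
      obtain ⟨b, hb⟩ := hyz i
      exact ⟨a + b, by push_cast; linear_combination ha + hb⟩

/-- `𝔻_Ω = {i | Ω_i = ℤ}` for the orbit `Ω` of `λ`. -/
def DD (lam : Fin n → K) : Set (Fin n) := {i | ∃ z : ℤ, lam i = (z : K)}

/-- `λ` is the normalized representative of its orbit: integer coordinates are `0`. -/
def IsNormalized (lam : Fin n → K) : Prop := ∀ i, (∃ z : ℤ, lam i = (z : K)) → lam i = 0


-- I_1 specifics
/-- The matrix units `e_{st} = ∫^s ∂^t − ∫^{s+1} ∂^{t+1}` of `𝕀_1`. -/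
def eEl1 (s t : ℕ) : In K 1 :=
  intEl K 1 0 ^ s * dEl K 1 0 ^ t - intEl K 1 0 ^ (s + 1) * dEl K 1 0 ^ (t + 1)

/-- `F = ⊕ K e_{st}`, the unique proper two-sided ideal of `𝕀_1`, here as the left ideal
generated by the `e_{st}` (the two coincide). -/
def Fideal : Submodule (In K 1) (In K 1) :=
  Submodule.span (In K 1) {a | ∃ s t : ℕ, a = eEl1 K s t}

/-- The left ideal `F + 𝕀_1 (H − μ)^s`. -/
def MslIdeal (s : ℕ) (mu : K) : Submodule (In K 1) (In K 1) :=
  Fideal K ⊔ Submodule.span (In K 1) {(HEl K 1 0 - algebraMap K (In K 1) mu) ^ s}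

/-- The `𝕀_1`-module `M(s,μ) = 𝕀_1/(F + 𝕀_1 (H − μ)^s)`. -/
def Msl (s : ℕ) (mu : K) := (In K 1) ⧸ MslIdeal K s mu

instance (s : ℕ) (mu : K) : AddCommGroup (Msl K s mu) :=
  inferInstanceAs (AddCommGroup ((In K 1) ⧸ MslIdeal K s mu))
instance (s : ℕ) (mu : K) : Module (In K 1) (Msl K s mu) :=
  inferInstanceAs (Module (In K 1) ((In K 1) ⧸ MslIdeal K s mu))
instance (s : ℕ) (mu : K) : Module K (Msl K s mu) :=
  inferInstanceAs (Module K ((In K 1) ⧸ MslIdeal K s mu))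
instance (s : ℕ) (mu : K) : IsScalarTower K (In K 1) (Msl K s mu) :=
  inferInstanceAs (IsScalarTower K (In K 1) ((In K 1) ⧸ MslIdeal K s mu))

-- two-sided ideals of I_n
/-- The element `e_{st}(i) ∈ 𝕀_n` built from the `i`-th tensor factor. -/
def eElN (i : Fin n) (s t : ℕ) : In K n :=
  intEl K n i ^ s * dEl K n i ^ t - intEl K n i ^ (s + 1) * dEl K n i ^ (t + 1)

/-- The height one prime `𝔭_i`, the two-sided ideal of `𝕀_n` generated by `F(i)`. -/
def pIdeal (i : Fin n) : TwoSidedIdeal (In K n) :=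
  TwoSidedIdeal.span {a | ∃ s t : ℕ, a = eElN K n i s t}

/-- `𝔞_n(I) = Σ_{i ∈ I} 𝔭_i`. -/
def aIdeal (I : Set (Fin n)) : TwoSidedIdeal (In K n) := ⨆ i ∈ I, pIdeal K n i


-- bundled modules
universe u

/-- A bundled `𝕀_n`-module (with compatible `K`-structure). -/
structure ModN (K : Type u) [Field K] [CharZero K] (n : ℕ) : Type (u + 1) where
  carrier : Type u
  [instAdd : AddCommGroup carrier]
  [instK : Module K carrier]
  [instIn : Module (In K n) carrier]
  [instTower : IsScalarTower K (In K n) carrier]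

attribute [instance] ModN.instAdd ModN.instK ModN.instIn ModN.instTower

/-- The endomorphism of `M_1 ⊗ ⋯ ⊗ M_n` acting by `a ∈ 𝕀_1` on the `i`-th factor. -/
def tprodMap (Mi : Fin n → ModN K 1) (i : Fin n) (a : In K 1) :
    (⨂[K] j, (Mi j).carrier) →ₗ[K] ⨂[K] j, (Mi j).carrier :=
  PiTensorProduct.map (Function.update
    (fun j => (LinearMap.id : (Mi j).carrier →ₗ[K] (Mi j).carrier)) i
    (DistribMulAction.toLinearMap K ((Mi i).carrier) a))

/-- The `𝕀_n`-module `M` "is" the tensor product `M_1 ⊗ ⋯ ⊗ M_n` of the `𝕀_1`-modules `M_i`: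
there is a `K`-linear isomorphism under which the generators `x_i, ∂_i, ∫_i` of `𝕀_n` act on
the `i`-th tensor factor via the corresponding generators of `𝕀_1`. -/
def RealizesTensor (Mi : Fin n → ModN K 1) (M : Type*) [AddCommGroup M] [Module K M]
    [Module (In K n) M] [IsScalarTower K (In K n) M] : Prop :=
  ∃ φ : M ≃ₗ[K] ⨂[K] j, (Mi j).carrier,
    ∀ (i : Fin n) (m : M),
      φ (xEl K n i • m) = tprodMap K n Mi i (xEl K 1 0) (φ m) ∧
      φ (dEl K n i • m) = tprodMap K n Mi i (dEl K 1 0) (φ m) ∧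
      φ (intEl K n i • m) = tprodMap K n Mi i (intEl K 1 0) (φ m)

/-- `M` is (isomorphic to) the simple weight module `M(𝒟_Ω)` attached to the orbit of `λ`
and the subset `𝒟 ⊆ 𝔻_Ω`: the tensor product of copies of `K[x]` (for `i ∈ 𝒟`) and of
`M(1, λ_i)` (for `i ∉ 𝒟`). -/
def RealizesMD (lam : Fin n → K) (D : Set (Fin n)) (M : Type*) [AddCommGroup M] [Module K M]
    [Module (In K n) M] [IsScalarTower K (In K n) M] : Prop :=
  ∃ Mi : Fin n → ModN K 1,
    (∀ i, i ∈ D → Nonempty ((Mi i).carrier ≃ₗ[In K 1] P K 1)) ∧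
    (∀ i, i ∉ D → Nonempty ((Mi i).carrier ≃ₗ[In K 1] Msl K 1 (lam i))) ∧
    RealizesTensor K n Mi M

/-- `M` is (isomorphic to) the module `P_{n-1} ⊗ M(s, λ)` (with the copy of `M(s,λ)` placed
in position `j`). -/
def RealizesPMs (lam : Fin n → K) (j : Fin n) (s : ℕ) (M : Type*) [AddCommGroup M] [Module K M]
    [Module (In K n) M] [IsScalarTower K (In K n) M] : Prop :=
  ∃ Mi : Fin n → ModN K 1,
    (∀ i, i ≠ j → Nonempty ((Mi i).carrier ≃ₗ[In K 1] P K 1)) ∧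
    Nonempty ((Mi j).carrier ≃ₗ[In K 1] Msl K s (lam j)) ∧
    RealizesTensor K n Mi M

/-- Membership in the category `GW(𝕀_n, 𝒟_Ω)`: generalized weight modules with support in the
orbit of `λ` all of whose simple subquotients are isomorphic to `M(𝒟_Ω)`. -/
def InGWD (lam : Fin n → K) (D : Set (Fin n)) (M : Type*) [AddCommGroup M] [Module K M]
    [Module (In K n) M] [IsScalarTower K (In K n) M] : Prop :=
  IsGenWeightModule K n M ∧ supp K n M ⊆ orbitOf K n lam ∧
  ∀ (p q : Submodule (In K n) M), p ≤ q →
    IsSimpleModule (In K n) (q ⧸ Submodule.comap q.subtype p) →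
    RealizesMD K n lam D (q ⧸ Submodule.comap q.subtype p)

/-- The support `S(𝒟_Ω) = ℕ_+^{𝒟_Ω} × ∏_{i ∉ 𝒟_Ω} (λ_i + ℤ)` of the module `M(𝒟_Ω)`. -/
def SuppMD (lam : Fin n → K) (D : Set (Fin n)) : Set (Fin n → K) :=
  {mu | (∀ i ∈ D, ∃ m : ℕ, 0 < m ∧ mu i = (m : K)) ∧
        (∀ i ∉ D, ∃ z : ℤ, mu i = lam i + (z : K))}

/-- `M` is an absolutely prime `𝕀_n`-module: its annihilator is a prime ideal and every
nonzero subfactor of `M` has the same annihilator. -/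
def IsAbsolutelyPrime (M : Type*) [AddCommGroup M] [Module K M]
    [Module (In K n) M] [IsScalarTower K (In K n) M] : Prop :=
  IsPrimeSet K n (annSet K n M) ∧
  ∀ (p q : Submodule (In K n) M), p ≤ q →
    Nontrivial (q ⧸ Submodule.comap q.subtype p) →
    annSet K n (q ⧸ Submodule.comap q.subtype p) = annSet K n M


-- the commutative subalgebra D_n = K[H_1, …, H_n]
lemma xEl_smul (i : Fin n) (p : P K n) : xEl K n i • p = MvPolynomial.X i * p := rfl

lemma dEl_smul (i : Fin n) (p : P K n) : dEl K n i • p = MvPolynomial.pderiv i p := rfl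

lemma hEl_monomial (i : Fin n) (α : Fin n →₀ ℕ) (c : K) :
    HEl K n i • (MvPolynomial.monomial α c : P K n)
      = (((α i : ℕ) : K) + 1) • MvPolynomial.monomial α c := by
  have hx : xEl K n i • (MvPolynomial.monomial α c : P K n)
      = MvPolynomial.monomial (α + Finsupp.single i 1) c := by
    rw [xEl_smul, MvPolynomial.X, MvPolynomial.monomial_mul, one_mul, add_comm]
  rw [HEl, mul_smul, hx, dEl_smul, MvPolynomial.pderiv_monomial,
    add_tsub_cancel_right, MvPolynomial.smul_monomial, Finsupp.add_apply,
    Finsupp.single_eq_same, smul_eq_mul]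
  congr 1
  push_cast
  ring

private lemma In_ext {a b : In K n} (h : ∀ p : P K n, a • p = b • p) : a = b := by
  have : (show InSub K n from a) = (show InSub K n from b) :=
    Subtype.ext (LinearMap.ext fun p => h p)
  exact this

lemma hEl_comm (i j : Fin n) : HEl K n i * HEl K n j = HEl K n j * HEl K n i := by
  apply In_ext
  intro p
  induction p using MvPolynomial.induction_on' with
  | monomial α c =>
      have key : ∀ a b : Fin n, (HEl K n a * HEl K n b) • (MvPolynomial.monomial α c : P K n)
          = ((((α b : ℕ) : K) + 1) * (((α a : ℕ) : K) + 1)) • MvPolynomial.monomial α c := by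
        intro a b
        rw [mul_smul, hEl_monomial, ← smul_comm, hEl_monomial, smul_smul]
      rw [key, key, mul_comm]
  | add p q hp hq =>
      rw [smul_add, smul_add, hp, hq]

/-- `D_n = K[H_1, …, H_n]` as a subalgebra of `𝕀_n`. -/
def DnSub : Subalgebra K (In K n) := Algebra.adjoin K (Set.range (HEl K n))

/-- The commutative algebra `D_n` (as a type). -/
def Dn : Type _ := DnSub K n

instance : CommRing (Dn K n) :=
  Algebra.adjoinCommRingOfComm K (by rintro a ⟨i, rfl⟩ b ⟨j, rfl⟩; exact hEl_comm K n i j)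

instance : Algebra K (Dn K n) := inferInstanceAs (Algebra K (DnSub K n))

/-- The inclusion `D_n → 𝕀_n`. -/
def dnVal : Dn K n →+* In K n := ((DnSub K n).val : DnSub K n →ₐ[K] In K n).toRingHom

/-- `H_i` as an element of `D_n`. -/
def HElD (i : Fin n) : Dn K n :=
  show DnSub K n from ⟨HEl K n i, Algebra.subset_adjoin ⟨i, rfl⟩⟩

lemma dn_comm (d : Dn K n) (i : Fin n) :
    dnVal K n d * HEl K n i = HEl K n i * dnVal K n d := by
  have h1 : DnSub K n ≤ Subalgebra.centralizer K (Set.range (HEl K n)) := by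
    apply Algebra.adjoin_le
    rintro x ⟨j, rfl⟩
    rw [SetLike.mem_coe, Subalgebra.mem_centralizer_iff]
    rintro g ⟨i', rfl⟩
    exact hEl_comm K n i' j
  have h2 := (Subalgebra.mem_centralizer_iff K).mp
    (h1 (show DnSub K n from d).2) (HEl K n i) ⟨i, rfl⟩
  exact h2.symm


section DnModules

variable (M : Type*) [AddCommGroup M] [Module K M] [Module (In K n) M]
  [IsScalarTower K (In K n) M]

lemma genWS_stable (lam : Fin n → K) {m : M} (hm : m ∈ genWeightSpace K n M lam)
    (d : Dn K n) : dnVal K n d • m ∈ genWeightSpace K n M lam := by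
  obtain ⟨N, hN⟩ := hm
  refine ⟨N, fun i => ?_⟩
  have hc : Commute (dnVal K n d) ((HEl K n i - algebraMap K (In K n) (lam i)) ^ N) := by
    apply Commute.pow_right
    exact Commute.sub_right (dn_comm K n d i) ((Algebra.commutes (lam i) (dnVal K n d)).symm)
  rw [← mul_smul, ← hc.eq, mul_smul, hN i, smul_zero]

instance genWS_smul (lam : Fin n → K) : SMul (Dn K n) (genWeightSpace K n M lam) :=
  ⟨fun d w => ⟨dnVal K n d • (w : M), genWS_stable K n M lam w.2 d⟩⟩

instance genWS_module (lam : Fin n → K) : Module (Dn K n) (genWeightSpace K n M lam) :=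
  Module.ofMinimalAxioms
    (fun d x y => Subtype.ext (smul_add (dnVal K n d) (x : M) (y : M)))
    (fun d d' x => Subtype.ext (show dnVal K n (d + d') • (x : M)
      = dnVal K n d • (x : M) + dnVal K n d' • (x : M) by rw [map_add, add_smul]))
    (fun d d' x => Subtype.ext (show dnVal K n (d * d') • (x : M)
      = dnVal K n d • (dnVal K n d' • (x : M)) by rw [map_mul, mul_smul]))
    (fun x => Subtype.ext (show dnVal K n 1 • (x : M) = (x : M) by rw [map_one, one_smul]))

instance genWS_tower (lam : Fin n → K) :
    IsScalarTower K (Dn K n) (genWeightSpace K n M lam) :=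
  ⟨fun c d w => Subtype.ext (show dnVal K n (c • d) • (w : M) = c • (dnVal K n d • (w : M)) by
    rw [show dnVal K n (c • d) = c • dnVal K n d from map_smul (DnSub K n).val c d, smul_assoc])⟩

end DnModules

/-- The maximal ideal `𝔪_λ = (H_1 − λ_1, …, H_n − λ_n)` of `D_n`. -/
def mIdeal (lam : Fin n → K) : Ideal (Dn K n) :=
  Ideal.span {d | ∃ i, d = HElD K n i - algebraMap K (Dn K n) (lam i)}

/-- The category `LF_𝔪(D_n)` of `𝔪_λ`-locally finite `D_n`-modules: every cyclic submodule is
finite dimensional over `K` and annihilated by a power of `𝔪_λ`. -/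
def IsLF (lam : Fin n → K) (N : Type*) [AddCommGroup N] [Module K N] [Module (Dn K n) N]
    [IsScalarTower K (Dn K n) N] : Prop :=
  ∀ x : N, FiniteDimensional K ((Submodule.span (Dn K n) {x}).restrictScalars K) ∧
    ∃ s : ℕ, ∀ i, ((HElD K n i - algebraMap K (Dn K n) (lam i)) ^ s) • x = 0

-- the algebra B_n = 𝕀_n/𝔞_n
/-- The maximal ideal `𝔞_n = 𝔭_1 + ⋯ + 𝔭_n` of `𝕀_n`. -/
def aFull : TwoSidedIdeal (In K n) := aIdeal K n Set.univ

/-- The skew Laurent polynomial algebra `B_n = 𝕀_n/𝔞_n`. -/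
def Bn : Type _ := (aFull K n).ringCon.Quotient

instance : Ring (Bn K n) := inferInstanceAs (Ring (aFull K n).ringCon.Quotient)

/-- The quotient map `𝕀_n → B_n`. -/
def toBn : In K n →+* Bn K n := RingCon.mk' _

lemma toBn_surjective : Function.Surjective (toBn K n) :=
  Quotient.mk''_surjective

/-- The composite `D_n → 𝕀_n → B_n`. -/
def bnD : Dn K n →+* Bn K n := (toBn K n).comp (dnVal K n)

/-- `B_n` as a right `D_n`-module (written as a left module structure, `d • b = b ⬝ d`). -/
instance : SMul (Dn K n) (Bn K n) := ⟨fun d b => b * bnD K n d⟩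

instance : Module (Dn K n) (Bn K n) :=
  Module.ofMinimalAxioms
    (fun d x y => show (x + y) * bnD K n d = x * bnD K n d + y * bnD K n d from add_mul _ _ _)
    (fun d d' x => show x * bnD K n (d + d') = x * bnD K n d + x * bnD K n d' by
      rw [map_add, mul_add])
    (fun d d' x => show x * bnD K n (d * d') = (x * bnD K n d') * bnD K n d by
      rw [mul_comm d d', map_mul, ← mul_assoc])
    (fun x => show x * bnD K n 1 = x by rw [map_one, mul_one])

instance : SMulCommClass (Dn K n) (Bn K n) (Bn K n) :=
  ⟨fun d b m => show (b * m) * bnD K n d = b * (m * bnD K n d) from mul_assoc b m (bnD K n d)⟩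

/-- The induced module `B_n ⊗_{D_n} N` of a `D_n`-module `N`. -/
def Ind (N : Type*) [AddCommGroup N] [Module (Dn K n) N] : Type _ :=
  (Bn K n) ⊗[Dn K n] N

section Ind

variable (N : Type*) [AddCommGroup N] [Module (Dn K n) N]

instance : AddCommGroup (Ind K n N) :=
  inferInstanceAs (AddCommGroup ((Bn K n) ⊗[Dn K n] N))

instance indModuleBn : Module (Bn K n) (Ind K n N) :=
  inferInstanceAs (Module (Bn K n) ((Bn K n) ⊗[Dn K n] N))

instance indModuleDn : Module (Dn K n) (Ind K n N) :=
  inferInstanceAs (Module (Dn K n) ((Bn K n) ⊗[Dn K n] N))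

instance indModuleIn : Module (In K n) (Ind K n N) := Module.compHom _ (toBn K n)

instance indModuleK : Module K (Ind K n N) := Module.compHom _ (algebraMap K (Dn K n))

lemma bn_algebraMap_comm (c : K) (u : Bn K n) :
    toBn K n (algebraMap K (In K n) c) * u = u * toBn K n (algebraMap K (In K n) c) := by
  obtain ⟨r, rfl⟩ := toBn_surjective K n u
  rw [← map_mul, ← map_mul, Algebra.commutes]

lemma dnVal_algebraMap (c : K) :
    dnVal K n (algebraMap K (Dn K n) c) = algebraMap K (In K n) c :=
  AlgHom.commutes (DnSub K n).val c

lemma ind_key (c : K) (w : (Bn K n) ⊗[Dn K n] N) :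
    (toBn K n (algebraMap K (In K n) c)) • w = (algebraMap K (Dn K n) c) • w := by
  induction w using TensorProduct.induction_on with
  | zero => rw [smul_zero, smul_zero]
  | tmul b x =>
      rw [TensorProduct.smul_tmul', TensorProduct.smul_tmul']
      congr 1
      show toBn K n (algebraMap K (In K n) c) * b = b * bnD K n (algebraMap K (Dn K n) c)
      have h1 : bnD K n (algebraMap K (Dn K n) c) = toBn K n (algebraMap K (In K n) c) := by
        show toBn K n (dnVal K n (algebraMap K (Dn K n) c)) = _
        rw [dnVal_algebraMap]
      rw [h1, bn_algebraMap_comm]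
  | add x y hx hy => rw [smul_add, smul_add, hx, hy]

instance indTower : IsScalarTower K (In K n) (Ind K n N) := by
  constructor
  intro c a v
  show toBn K n (c • a) • v = algebraMap K (Dn K n) c • ((toBn K n a : Bn K n) • v)
  rw [Algebra.smul_def, map_mul, mul_smul]
  exact ind_key K n N c _

end Ind


section BnQuot

variable (J : Submodule (Bn K n) (Bn K n))

instance : Module (In K n) (Bn K n ⧸ J) := Module.compHom _ (toBn K n)

instance : Module K (Bn K n ⧸ J) :=
  Module.compHom _ ((toBn K n).comp (algebraMap K (In K n)))

instance : IsScalarTower K (In K n) (Bn K n ⧸ J) := by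
  constructor
  intro c a v
  show toBn K n (c • a) • v = (toBn K n (algebraMap K (In K n) c)) • (toBn K n a • v)
  rw [Algebra.smul_def, map_mul, mul_smul]

end BnQuot

/-- The `𝕀_n`-module `M` "is" the tensor product `A ⊗ B` of an `𝕀_m`-module `A` and an
`𝕀_{n-m}`-module `B`: there is a `K`-linear isomorphism under which the generators of `𝕀_n`
with index `< m` act on the first factor (via the corresponding generators of `𝕀_m`) and the
remaining generators act on the second factor (via the generators of `𝕀_{n-m}`). -/
def RealizesSplit (m : ℕ) (A : Type*) [AddCommGroup A] [Module K A] [Module (In K m) A]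
    [IsScalarTower K (In K m) A]
    (B : Type*) [AddCommGroup B] [Module K B] [Module (In K (n - m)) B]
    [IsScalarTower K (In K (n - m)) B]
    (M : Type*) [AddCommGroup M] [Module K M] [Module (In K n) M]
    [IsScalarTower K (In K n) M] : Prop :=
  ∃ φ : M ≃ₗ[K] A ⊗[K] B,
    (∀ (i : Fin n) (hi : (i : ℕ) < m) (v : M),
      φ (xEl K n i • v) = LinearMap.rTensor B
        (DistribMulAction.toLinearMap K A (xEl K m ⟨i, hi⟩)) (φ v) ∧
      φ (dEl K n i • v) = LinearMap.rTensor B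
        (DistribMulAction.toLinearMap K A (dEl K m ⟨i, hi⟩)) (φ v) ∧
      φ (intEl K n i • v) = LinearMap.rTensor B
        (DistribMulAction.toLinearMap K A (intEl K m ⟨i, hi⟩)) (φ v)) ∧
    (∀ (i : Fin n) (hi : m ≤ (i : ℕ)) (v : M),
      φ (xEl K n i • v) = LinearMap.lTensor A
        (DistribMulAction.toLinearMap K B (xEl K (n - m) ⟨(i : ℕ) - m, by omega⟩)) (φ v) ∧
      φ (dEl K n i • v) = LinearMap.lTensor A
        (DistribMulAction.toLinearMap K B (dEl K (n - m) ⟨(i : ℕ) - m, by omega⟩)) (φ v) ∧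
      φ (intEl K n i • v) = LinearMap.lTensor A
        (DistribMulAction.toLinearMap K B (intEl K (n - m) ⟨(i : ℕ) - m, by omega⟩)) (φ v))

end


set_option maxHeartbeats 1000000
set_option synthInstance.maxHeartbeats 400000

section Aux1
variable (K : Type*) [Field K] [CharZero K] (n : ℕ)

lemma In_ext_mon {a b : In K n}
    (h : ∀ (α : Fin n →₀ ℕ) (c : K), a • (MvPolynomial.monomial α c : P K n)
      = b • (MvPolynomial.monomial α c : P K n)) : a = b := by
  have : (show InSub K n from a) = (show InSub K n from b) := by
    refine Subtype.ext (LinearMap.ext fun p => ?_)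
    show a • p = b • p
    induction p using MvPolynomial.induction_on' with
    | monomial α c => exact h α c
    | add p q hp hq => rw [smul_add, smul_add, hp, hq]
  exact this

lemma x_mon (i : Fin n) (α : Fin n →₀ ℕ) (c : K) :
    xEl K n i • (MvPolynomial.monomial α c : P K n)
      = MvPolynomial.monomial (α + Finsupp.single i 1) c := by
  rw [xEl_smul, MvPolynomial.X, MvPolynomial.monomial_mul, one_mul, add_comm]

lemma d_mon (i : Fin n) (α : Fin n →₀ ℕ) (c : K) :
    dEl K n i • (MvPolynomial.monomial α c : P K n)
      = MvPolynomial.monomial (α - Finsupp.single i 1) (c * (α i : K)) := by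
  rw [dEl_smul, MvPolynomial.pderiv_monomial]

lemma int_mon (i : Fin n) (α : Fin n →₀ ℕ) (c : K) :
    intEl K n i • (MvPolynomial.monomial α c : P K n)
      = MvPolynomial.monomial (α + Finsupp.single i 1) (c * ((α i : K) + 1)⁻¹) := by
  show intOp K n i (MvPolynomial.monomial α c) = _
  have : (MvPolynomial.monomial α c : P K n) = c • MvPolynomial.basisMonomials (Fin n) K α := by
    rw [MvPolynomial.coe_basisMonomials, MvPolynomial.smul_monomial, smul_eq_mul, mul_one]
  rw [this, map_smul, intOp, Module.Basis.constr_basis, MvPolynomial.smul_monomial,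
    MvPolynomial.smul_monomial]
  simp

lemma natne (k : ℕ) : (k : K) + 1 ≠ 0 := by exact_mod_cast Nat.succ_ne_zero k

lemma d_int (i : Fin n) : dEl K n i * intEl K n i = 1 := by
  apply In_ext_mon; intro α c
  rw [mul_smul, int_mon, d_mon, one_smul, add_tsub_cancel_right]
  have := natne K (α i)
  congr 1
  simp [this]

lemma int_H (i : Fin n) : intEl K n i * HEl K n i = xEl K n i := by
  apply In_ext_mon; intro α c
  rw [mul_smul, hEl_monomial, MvPolynomial.smul_monomial, int_mon, x_mon]
  have := natne K (α i)
  congr 1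
  simp only [smul_eq_mul]
  field_simp

lemma d_H (i : Fin n) : dEl K n i * HEl K n i = (HEl K n i + 1) * dEl K n i := by
  apply In_ext_mon; intro α c
  rw [mul_smul, mul_smul, hEl_monomial, MvPolynomial.smul_monomial, d_mon, d_mon, add_smul (HEl K n i),
    hEl_monomial, one_smul, MvPolynomial.smul_monomial, ← map_add]
  congr 1
  simp only [smul_eq_mul, Finsupp.tsub_apply, Finsupp.single_eq_same]
  rcases Nat.eq_zero_or_pos (α i) with h | h
  · simp [h]
  · rw [Nat.cast_sub h]; push_cast; ring

lemma H_int (i : Fin n) : HEl K n i * intEl K n i = intEl K n i * (HEl K n i + 1) := by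
  apply In_ext_mon; intro α c
  rw [mul_smul, mul_smul, int_mon, hEl_monomial, add_smul (HEl K n i), hEl_monomial, one_smul, smul_add,
    MvPolynomial.smul_monomial, MvPolynomial.smul_monomial, int_mon, int_mon,
    ← map_add]
  congr 1
  simp only [smul_eq_mul, Finsupp.add_apply, Finsupp.single_eq_same]
  push_cast; ring

/-- `e_{00}(i)` -/
noncomputable def eZ (i : Fin n) : In K n := 1 - intEl K n i * dEl K n i

lemma H_eZ (i : Fin n) : HEl K n i * eZ K n i = eZ K n i := by
  apply In_ext_mon; intro α c
  rw [mul_smul, eZ, sub_smul, one_smul, mul_smul, d_mon, int_mon]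
  rcases Nat.eq_zero_or_pos (α i) with h | h
  · simp [h, hEl_monomial]
  · have h2 : α - Finsupp.single i 1 + Finsupp.single i 1 = α := by
      apply tsub_add_cancel_of_le
      simpa using (show 1 ≤ α i from h)
    have h3 : (α i : K) ≠ 0 := by exact_mod_cast h.ne'
    rw [h2]
    simp only [Finsupp.tsub_apply, Finsupp.single_eq_same]
    rw [Nat.cast_sub h]
    simp [h3]

lemma eZ_H (i : Fin n) : eZ K n i * HEl K n i = eZ K n i := by
  have : eZ K n i * HEl K n i = HEl K n i * eZ K n i := by
    rw [eZ, sub_mul, mul_sub, one_mul, mul_one, mul_assoc, d_H, ← mul_assoc, ← mul_assoc,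
      H_int]
  rw [this, H_eZ]

lemma eZ_int (i : Fin n) : eZ K n i * intEl K n i = 0 := by
  rw [eZ, sub_mul, mul_assoc, d_int]; simp

lemma d_eZ (i : Fin n) : dEl K n i * eZ K n i = 0 := by
  rw [eZ, mul_sub, ← mul_assoc, d_int]; simp

lemma eZ_eZ (i : Fin n) : eZ K n i * eZ K n i = eZ K n i := by
  have : eZ K n i * eZ K n i = eZ K n i - intEl K n i * (dEl K n i * eZ K n i) := by
    conv_lhs => rw [eZ]
    rw [sub_mul, one_mul, mul_assoc]; rfl
  rw [this, d_eZ, mul_zero, sub_zero]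

lemma d_d (i j : Fin n) : Commute (dEl K n i) (dEl K n j) := by
  by_cases hij : i = j
  · subst hij; exact Commute.refl _
  apply In_ext_mon; intro α c
  rw [mul_smul, mul_smul, d_mon, d_mon, d_mon, d_mon]
  congr 1
  · congr 1; exact tsub_right_comm
  · simp [hij, Ne.symm hij]; ring

lemma d_int_ne {i j : Fin n} (hij : i ≠ j) : Commute (dEl K n i) (intEl K n j) := by
  apply In_ext_mon; intro α c
  rw [mul_smul, mul_smul, d_mon, int_mon, int_mon, d_mon]
  congr 1
  · congr 1; ext k
    by_cases h1 : k = i <;> by_cases h2 : k = j <;> simp_all [Finsupp.single_apply, eq_comm]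
  · simp [hij, Ne.symm hij]; ring

lemma d_x_ne {i j : Fin n} (hij : i ≠ j) : Commute (dEl K n i) (xEl K n j) := by
  apply In_ext_mon; intro α c
  rw [mul_smul, mul_smul, d_mon, x_mon, x_mon, d_mon]
  congr 1
  · congr 1; ext k
    by_cases h1 : k = i <;> by_cases h2 : k = j <;> simp_all [Finsupp.single_apply, eq_comm]
  · simp [hij]

lemma int_int (i j : Fin n) : Commute (intEl K n i) (intEl K n j) := by
  by_cases hij : i = j
  · subst hij; exact Commute.refl _
  apply In_ext_mon; intro α c
  rw [mul_smul, mul_smul, int_mon, int_mon, int_mon, int_mon]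
  congr 1
  · congr 1; exact add_right_comm _ _ _
  · simp [hij, Ne.symm hij]; ring

lemma int_x_ne {i j : Fin n} (hij : i ≠ j) : Commute (intEl K n i) (xEl K n j) := by
  apply In_ext_mon; intro α c
  rw [mul_smul, mul_smul, x_mon, int_mon, int_mon, x_mon]
  congr 1
  · congr 1; exact add_right_comm _ _ _
  · simp [hij]

lemma d_H_ne {i j : Fin n} (hij : i ≠ j) : Commute (dEl K n i) (HEl K n j) :=
  (d_d K n i j).mul_right (d_x_ne K n hij)

lemma int_H_ne {i j : Fin n} (hij : i ≠ j) : Commute (intEl K n i) (HEl K n j) :=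
  (d_int_ne K n hij.symm).symm.mul_right (int_x_ne K n hij)

lemma In_induction {p : In K n → Prop}
    (hH : ∀ i, p (HEl K n i)) (hd : ∀ i, p (dEl K n i)) (hi : ∀ i, p (intEl K n i))
    (hK : ∀ c, p (algebraMap K (In K n) c)) (hadd : ∀ a b, p a → p b → p (a + b))
    (hmul : ∀ a b, p a → p b → p (a * b)) (a : In K n) : p a := by
  have key : ∀ (f : Module.End K (P K n)) (hf : f ∈ InSub K n), p (⟨f, hf⟩ : InSub K n) := by
    intro f hf
    unfold InSub at hf
    induction hf using Algebra.adjoin_induction with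
    | mem x hx =>
      rcases hx with (⟨i, rfl⟩ | ⟨i, rfl⟩) | ⟨i, rfl⟩
      · have := hmul _ _ (hi i) (hH i)
        rw [int_H] at this
        exact this
      · exact hd i
      · exact hi i
    | algebraMap c => exact hK c
    | add x y hx hy h1 h2 => exact hadd _ _ h1 h2
    | mul x y hx hy h1 h2 => exact hmul _ _ h1 h2
  exact key a.1 a.2

/-- semiconjugation data -/
lemma sc_d (lam : Fin n → K) (i j : Fin n) :
    SemiconjBy (dEl K n i) (HEl K n j - algebraMap K (In K n) (lam j))
      (HEl K n j - algebraMap K (In K n) (Function.update lam i (lam i - 1) j)) := by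
  by_cases h : j = i
  · subst h
    simp only [Function.update_self, map_sub, map_one]
    unfold SemiconjBy
    rw [mul_sub, d_H, ← Algebra.commutes]
    noncomm_ring
  · rw [Function.update_of_ne h]
    exact (d_H_ne K n (Ne.symm h)).sub_right (Algebra.commutes _ _).symm

lemma sc_int (lam : Fin n → K) (i j : Fin n) :
    SemiconjBy (intEl K n i) (HEl K n j - algebraMap K (In K n) (lam j))
      (HEl K n j - algebraMap K (In K n) (Function.update lam i (lam i + 1) j)) := by
  by_cases h : j = i
  · subst h
    simp only [Function.update_self, map_add, map_one]
    unfold SemiconjBy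
    rw [sub_mul, H_int, add_mul, Algebra.commutes (lam j)]
    noncomm_ring
  · rw [Function.update_of_ne h]
    exact (int_H_ne K n (Ne.symm h)).sub_right (Algebra.commutes _ _).symm

lemma sc_e (c : K) (i : Fin n) :
    SemiconjBy (eZ K n i) (HEl K n i - algebraMap K (In K n) c)
      (algebraMap K (In K n) (1 - c)) := by
  unfold SemiconjBy
  rw [mul_sub, eZ_H, map_sub, sub_mul, map_one, one_mul, Algebra.commutes]

lemma d_pow_H (i : Fin n) (k : ℕ) :
    dEl K n i ^ k * HEl K n i = (HEl K n i + (k : In K n)) * dEl K n i ^ k := by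
  induction k with
  | zero => simp
  | succ k ih =>
    rw [pow_succ', mul_assoc, ih, ← mul_assoc, mul_add, d_H, ← (Nat.cast_commute k _).eq]
    push_cast
    noncomm_ring

end Aux1


section Aux2
variable (K : Type*) [Field K] [CharZero K] (n : ℕ)

lemma path_rel (R : (Fin n → K) → (Fin n → K) → Prop) (hR : Equivalence R) (A : Fin n → Prop)
    (step : ∀ i lam, (A i ∨ lam i ≠ 1) → R lam (Function.update lam i (lam i - 1)))
    (mu nu : Fin n → K) (horb : ∀ i, ∃ z : ℤ, mu i - nu i = (z : K))
    (h : ∀ i, A i ∨ ((∃ k : ℕ, mu i = (k : K) + 1) ∧ ∃ k : ℕ, nu i = (k : K) + 1)) : R mu nu := by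
  have h1 : ∀ (i : Fin n) (lam : Fin n → K) (c : K) (k : ℕ), (A i ∨ ∃ l : ℕ, c = (l : K) + 1) →
      R (Function.update lam i (c + k)) (Function.update lam i c) := by
    intro i lam c k hc
    induction k with
    | zero => simpa using hR.refl _
    | succ k ih =>
      refine hR.trans ?_ ih
      have := step i (Function.update lam i (c + (k + 1 : ℕ))) (by
        rcases hc with hc | ⟨l, rfl⟩
        · exact Or.inl hc
        · right
          rw [Function.update_self]
          intro h
          have : ((l + k + 1 : ℕ) : K) = 0 := by push_cast at h ⊢; linear_combination h
          exact absurd this (by exact_mod_cast Nat.succ_ne_zero (l + k)))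
      rw [Function.update_self, Function.update_idem] at this
      convert this using 2
      push_cast; ring
  have h2 : ∀ (i : Fin n) (lam : Fin n → K),
      R (Function.update lam i (mu i)) (Function.update lam i (nu i)) := by
    intro i lam
    obtain ⟨z, hz⟩ := horb i
    rcases le_total 0 z with hz0 | hz0
    · lift z to ℕ using hz0
      have : mu i = nu i + (z : ℕ) := by push_cast at hz; linear_combination hz
      rw [this]
      exact h1 i lam _ z ((h i).imp id (fun h => h.2))
    · obtain ⟨k, rfl⟩ : ∃ k : ℕ, z = -k := ⟨(-z).toNat, by omega⟩
      have : nu i = mu i + (k : ℕ) := by push_cast at hz; linear_combination -hz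
      rw [this]
      exact hR.symm (h1 i lam _ k ((h i).imp id (fun h => h.1)))
  classical
  have h3 : ∀ s : Finset (Fin n), R mu (s.piecewise nu mu) := by
    intro s
    induction s using Finset.induction_on with
    | empty => simpa using hR.refl _
    | insert i s hi ih =>
      refine hR.trans ih ?_
      rw [Finset.piecewise_insert]
      have := h2 i (s.piecewise nu mu)
      rwa [show Function.update (s.piecewise nu mu) i (mu i) = s.piecewise nu mu by
        conv_lhs => rw [← Finset.piecewise_eq_of_notMem s nu mu hi]
        exact Function.update_eq_self _ _] at this
  simpa using h3 Finset.univ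

variable (M : Type*) [AddCommGroup M] [Module K M] [Module (In K n) M]
  [IsScalarTower K (In K n) M]

lemma amap_smul (c : K) (m : M) : algebraMap K (In K n) c • m = c • m := algebraMap_smul _ _ _

lemma genWS_eq (lam : Fin n → K) : genWeightSpace K n M lam =
    ⨅ i, Module.End.maxGenEigenspace (DistribSMul.toLinearMap K M (HEl K n i)) (lam i) := by
  have key : ∀ (i : Fin n) (k : ℕ) (m : M),
      ((DistribSMul.toLinearMap K M (HEl K n i) - lam i • (1 : Module.End K M)) ^ k) m
      = ((HEl K n i - algebraMap K (In K n) (lam i)) ^ k) • m := by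
    intro i k
    induction k with
    | zero => intro m; simp
    | succ k ih =>
      intro m
      rw [pow_succ, pow_succ, Module.End.mul_apply, mul_smul, ih, sub_smul, amap_smul]
      rfl
  ext m
  simp only [Submodule.mem_iInf, Module.End.mem_maxGenEigenspace, key]
  constructor
  · rintro ⟨N, hN⟩ i
    exact ⟨N, hN i⟩
  · intro h
    choose f hf using h
    refine ⟨∑ i, f i, fun i => ?_⟩
    obtain ⟨k, hk⟩ := Nat.exists_eq_add_of_le
      (Finset.single_le_sum (f := f) (fun j _ => Nat.zero_le _) (Finset.mem_univ i))
    rw [hk, add_comm, pow_add, mul_smul, hf, smul_zero]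

lemma genWS_indep : iSupIndep (genWeightSpace K n M) := by
  have := Module.End.independent_iInf_maxGenEigenspace_of_forall_mapsTo (R := K) (M := M)
    (fun i : Fin n => DistribSMul.toLinearMap K M (HEl K n i)) (by
      intro i j φ
      apply Module.End.mapsTo_maxGenEigenspace_of_comm
      apply LinearMap.ext
      intro m
      show HEl K n j • HEl K n i • m = HEl K n i • HEl K n j • m
      rw [← mul_smul, ← mul_smul, hEl_comm])
  rw [show genWeightSpace K n M = _ from funext (genWS_eq K n M)]
  exact this

lemma weight_le_gen (lam : Fin n → K) : weightSpace K n M lam ≤ genWeightSpace K n M lam := by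
  intro m hm
  refine ⟨1, fun i => ?_⟩
  rw [pow_one, sub_smul, amap_smul, hm i, sub_self]

variable {M}

lemma gw_iSup (h : IsGenWeightModule K n M) : ⨆ lam, genWeightSpace K n M lam = ⊤ := by
  let _ := Classical.decEq (Fin n → K)
  exact ((DirectSum.isInternal_submodule_iff_iSupIndep_and_iSup_eq_top _).1 h).2

/-- a vector in the span of a weight family -/
lemma exists_sum {F : (Fin n → K) → Submodule K M} (hF : ∀ lam, F lam ≤ genWeightSpace K n M lam)
    (h : ⨆ lam, F lam = ⊤) {mu : Fin n → K} : genWeightSpace K n M mu ≤ F mu := by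
  classical
  intro m hm
  have hm' : m ∈ ⨆ lam, F lam := h ▸ Submodule.mem_top
  obtain ⟨f, hf, rfl⟩ := (Submodule.mem_iSup_iff_exists_finsupp _ _).1 hm'
  have hind := (iSupIndep_iff_finsetSum_eq_zero_imp_eq_zero _).1 (genWS_indep K n M)
  set x := f.sum fun _ xi => xi with hx
  have h0 := hind (insert mu f.support) (fun lam => f lam - if lam = mu then x else 0) (by
      intro lam _
      apply Submodule.sub_mem _ (hF _ (hf _))
      split_ifs with h
      · rw [h]; exact hm
      · exact Submodule.zero_mem _) (by
      rw [Finset.sum_sub_distrib, Finset.sum_ite_eq' (insert mu f.support) mu, if_pos (Finset.mem_insert_self _ _), hx, Finsupp.sum]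
      rw [sub_eq_zero]
      symm
      apply Finset.sum_subset (Finset.subset_insert _ _)
      intro y _ hy
      exact Finsupp.notMem_support_iff.1 hy) mu (Finset.mem_insert_self _ _)
  simp only [if_true] at h0
  rw [← sub_eq_zero.1 h0]
  exact hf mu

lemma weight_eq_gen (h : IsWeightModule K n M) (mu : Fin n → K) :
    weightSpace K n M mu = genWeightSpace K n M mu := by
  let _ := Classical.decEq (Fin n → K)
  exact le_antisymm (weight_le_gen K n M mu) (exists_sum K n (weight_le_gen K n M)
    ((DirectSum.isInternal_submodule_iff_iSupIndep_and_iSup_eq_top _).1 h).2)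

lemma sc_mem {a : In K n} {lam mu : Fin n → K}
    (h : ∀ j, SemiconjBy a (HEl K n j - algebraMap K (In K n) (lam j))
      (HEl K n j - algebraMap K (In K n) (mu j))) {m : M}
    (hm : m ∈ genWeightSpace K n M lam) : a • m ∈ genWeightSpace K n M mu := by
  obtain ⟨N, hN⟩ := hm
  refine ⟨N, fun j => ?_⟩
  rw [← mul_smul, ← ((h j).pow_right N).eq, mul_smul, hN j, smul_zero]

lemma d_mem {lam : Fin n → K} (i : Fin n) {m : M} (hm : m ∈ genWeightSpace K n M lam) :
    dEl K n i • m ∈ genWeightSpace K n M (Function.update lam i (lam i - 1)) :=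
  sc_mem K n (sc_d K n lam i) hm

lemma int_mem {lam : Fin n → K} (i : Fin n) {m : M} (hm : m ∈ genWeightSpace K n M lam) :
    intEl K n i • m ∈ genWeightSpace K n M (Function.update lam i (lam i + 1)) :=
  sc_mem K n (sc_int K n lam i) hm

lemma int_mem' {lam : Fin n → K} (i : Fin n) {m : M}
    (hm : m ∈ genWeightSpace K n M (Function.update lam i (lam i - 1))) :
    intEl K n i • m ∈ genWeightSpace K n M lam := by
  have := int_mem K n i hm
  simpa using this

lemma H_mem {lam : Fin n → K} (i : Fin n) {m : M} (hm : m ∈ genWeightSpace K n M lam) :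
    HEl K n i • m ∈ genWeightSpace K n M lam :=
  sc_mem K n (fun j => (show Commute _ _ from hEl_comm K n i j).sub_right (Algebra.commutes _ _).symm) hm

lemma e_zero {lam : Fin n → K} (i : Fin n) {m : M} (hm : m ∈ genWeightSpace K n M lam)
    (hl : lam i ≠ 1) : eZ K n i • m = 0 := by
  obtain ⟨N, hN⟩ := hm
  have h := congrArg (· • m) ((sc_e K n (lam i) i).pow_right N).eq
  simp only [mul_smul] at h
  rw [hN i, smul_zero, ← map_pow, amap_smul] at h
  rcases smul_eq_zero.1 h.symm with h | h
  · exact absurd (eq_zero_of_pow_eq_zero h) (sub_ne_zero.2 hl.symm)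
  · exact h

lemma int_d_smul (i : Fin n) (m : M) (h : eZ K n i • m = 0) :
    intEl K n i • dEl K n i • m = m := by
  rw [eZ, sub_smul, one_smul, mul_smul, sub_eq_zero] at h
  exact h.symm

lemma d_int_smul (i : Fin n) (m : M) : dEl K n i • intEl K n i • m = m := by
  rw [← mul_smul, d_int, one_smul]

lemma rank_step (i : Fin n) (lam : Fin n → K) (h : (∀ m : M, eZ K n i • m = 0) ∨ lam i ≠ 1) :
    Module.rank K (genWeightSpace K n M lam)
      = Module.rank K (genWeightSpace K n M (Function.update lam i (lam i - 1))) := by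
  have he : ∀ m ∈ genWeightSpace K n M lam, eZ K n i • m = 0 := by
    intro m hm
    rcases h with h | h
    · exact h m
    · exact e_zero K n i hm h
  let f : genWeightSpace K n M lam →ₗ[K]
      genWeightSpace K n M (Function.update lam i (lam i - 1)) :=
    (DistribSMul.toLinearMap K M (dEl K n i)).restrict (fun m hm => d_mem K n i hm)
  let g : genWeightSpace K n M (Function.update lam i (lam i - 1)) →ₗ[K]
      genWeightSpace K n M lam :=
    (DistribSMul.toLinearMap K M (intEl K n i)).restrict (fun m hm => int_mem' K n i hm)
  refine LinearEquiv.rank_eq (LinearEquiv.ofLinearMap f g ?_ ?_)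
  · ext m
    exact d_int_smul K n i (m : M)
  · ext m
    exact int_d_smul K n i (m : M) (he m m.2)

/-- all weights good -/
def Good (M : Type*) [AddCommGroup M] [Module K M] [Module (In K n) M]
    [IsScalarTower K (In K n) M] : Prop :=
  ∀ i, (∀ m : M, eZ K n i • m = 0) ∨ (∀ lam ∈ supp K n M, ∃ k : ℕ, lam i = (k : K) + 1)

lemma rank_good (hg : Good K n M) {mu nu : Fin n → K}
    (hmu : mu ∈ supp K n M) (hnu : nu ∈ supp K n M)
    (horb : ∀ i, ∃ z : ℤ, mu i - nu i = (z : K)) :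
    Module.rank K (genWeightSpace K n M mu) = Module.rank K (genWeightSpace K n M nu) := by
  refine path_rel K n (fun a b => Module.rank K (genWeightSpace K n M a)
    = Module.rank K (genWeightSpace K n M b)) ⟨fun _ => rfl, Eq.symm, Eq.trans⟩
    (fun i => ∀ m : M, eZ K n i • m = 0) (fun i lam h => rank_step K n i lam h) mu nu horb ?_
  intro i
  exact (hg i).imp id (fun h => ⟨h _ hmu, h _ hnu⟩)

lemma mk_mem (q : Submodule (In K n) M) {lam : Fin n → K} {m : M}
    (hm : m ∈ genWeightSpace K n M lam) : q.mkQ m ∈ genWeightSpace K n (M ⧸ q) lam := by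
  obtain ⟨N, hN⟩ := hm
  refine ⟨N, fun j => ?_⟩
  rw [← map_smul, hN j, map_zero]

/-- submodules of generalized weight modules are graded -/
lemma exists_comp (h : ⨆ lam, genWeightSpace K n M lam = ⊤) {p q : Submodule (In K n) M}
    (hpq : p < q) : ∃ lam, ∃ m ∈ genWeightSpace K n M lam, m ∈ q ∧ m ∉ p := by
  obtain ⟨m, hmq, hmp⟩ := SetLike.exists_of_lt hpq
  have hm' : m ∈ ⨆ lam, genWeightSpace K n M lam := h ▸ Submodule.mem_top
  obtain ⟨f, hf, rfl⟩ := (Submodule.mem_iSup_iff_exists_finsupp _ _).1 hm'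
  have hind := (iSupIndep_iff_finsetSum_eq_zero_imp_eq_zero _).1 (genWS_indep K n (M ⧸ q))
    f.support (fun lam => q.mkQ (f lam)) (fun lam _ => mk_mem K n q (hf lam)) (by
      rw [← map_sum]
      exact (Submodule.Quotient.mk_eq_zero q).2 hmq)
  by_contra hcon
  push Not at hcon
  apply hmp
  apply Submodule.sum_mem
  intro lam hl
  exact hcon lam _ (hf lam) ((Submodule.Quotient.mk_eq_zero q).1 (hind lam hl))

lemma good_strict (h : ⨆ lam, genWeightSpace K n M lam = ⊤) (hg : Good K n M)
    (horb : ∀ mu ∈ supp K n M, ∀ nu ∈ supp K n M, ∀ i, ∃ z : ℤ, mu i - nu i = (z : K))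
    {p q : Submodule (In K n) M} (hpq : p < q) {mu : Fin n → K} (hmu : mu ∈ supp K n M) :
    ∃ m ∈ genWeightSpace K n M mu, m ∈ q ∧ m ∉ p := by
  obtain ⟨nu, hnu⟩ := exists_comp K n h hpq
  have hnus : nu ∈ supp K n M := by
    obtain ⟨m, hm, -, hm2⟩ := hnu
    intro hb
    rw [hb] at hm
    rw [(Submodule.mem_bot K).1 hm] at hm2
    exact hm2 p.zero_mem
  refine (path_rel K n (fun a b => (∃ m ∈ genWeightSpace K n M a, m ∈ q ∧ m ∉ p) ↔
      (∃ m ∈ genWeightSpace K n M b, m ∈ q ∧ m ∉ p))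
      ⟨fun _ => Iff.rfl, Iff.symm, Iff.trans⟩
    (fun i => ∀ m : M, eZ K n i • m = 0) (fun i lam h => ?_) mu nu (horb _ hmu _ hnus) ?_).2 hnu
  · have he : ∀ m ∈ genWeightSpace K n M lam, eZ K n i • m = 0 := by
      intro m hm
      rcases h with h | h
      · exact h m
      · exact e_zero K n i hm h
    constructor
    · rintro ⟨m, hm, hmq, hmp⟩
      refine ⟨dEl K n i • m, d_mem K n i hm, q.smul_mem _ hmq, fun hc => hmp ?_⟩
      rw [← int_d_smul K n i m (he m hm)]
      exact p.smul_mem _ hc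
    · rintro ⟨m, hm, hmq, hmp⟩
      refine ⟨intEl K n i • m, int_mem' K n i hm, q.smul_mem _ hmq, fun hc => hmp ?_⟩
      rw [← d_int_smul K n i m]
      exact p.smul_mem _ hc
  · intro i
    exact (hg i).imp id (fun h => ⟨h _ hmu, h _ hnus⟩)

end Aux2


section Aux3
variable (K : Type*) [Field K] [CharZero K]

lemma F_right (a : In K 1) : ∀ f ∈ Fideal K, f * a ∈ Fideal K := by
  have ee : ∀ s t, eEl1 K s t = intEl K 1 0 ^ s * eZ K 1 0 * dEl K 1 0 ^ t := by
    intro s t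
    rw [eEl1, eZ, mul_sub, mul_one, sub_mul, pow_succ, pow_succ', mul_assoc, mul_assoc, mul_assoc]
  have red : ∀ a : In K 1, (∀ s t, eEl1 K s t * a ∈ Fideal K) → ∀ f ∈ Fideal K, f * a ∈ Fideal K := by
    intro a ha f hf
    unfold Fideal at hf
    induction hf using Submodule.span_induction with
    | mem x hx => obtain ⟨s, t, rfl⟩ := hx; exact ha s t
    | zero => rw [zero_mul]; exact Submodule.zero_mem _
    | add x y _ _ hx hy => rw [add_mul]; exact Submodule.add_mem _ hx hy
    | smul r x _ hx =>
      rw [smul_eq_mul, mul_assoc]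
      exact Submodule.smul_mem (Fideal K) r hx
  have mem : ∀ s t, eEl1 K s t ∈ Fideal K := fun s t => Submodule.subset_span ⟨s, t, rfl⟩
  refine In_induction K 1 (p := fun a => ∀ f ∈ Fideal K, f * a ∈ Fideal K) ?_ ?_ ?_ ?_ ?_ ?_ a
  · intro i
    obtain rfl : i = 0 := Subsingleton.elim _ _
    apply red
    intro s t
    have : eEl1 K s t * HEl K 1 0 = (1 + (t : In K 1)) • eEl1 K s t := by
      rw [ee, mul_assoc, d_pow_H, ← mul_assoc, mul_assoc (intEl K 1 0 ^ s), mul_add, eZ_H,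
        smul_eq_mul, add_mul, one_mul, mul_add, add_mul]
      congr 1
      rw [mul_assoc _ (eZ K 1 0) _, ← (Nat.cast_commute t _).eq]
      simp only [mul_assoc]
      rw [← mul_assoc _ (t : In K 1), ← (Nat.cast_commute t _).eq]
      simp only [mul_assoc]
    rw [this]
    exact Submodule.smul_mem _ _ (mem s t)
  · intro i
    obtain rfl : i = 0 := Subsingleton.elim _ _
    apply red
    intro s t
    rw [ee, mul_assoc, ← pow_succ, ← ee]
    exact mem _ _
  · intro i
    obtain rfl : i = 0 := Subsingleton.elim _ _
    apply red
    intro s t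
    rw [ee]
    cases t with
    | zero => rw [pow_zero, mul_one, mul_assoc, eZ_int, mul_zero]; exact Submodule.zero_mem _
    | succ t =>
      rw [mul_assoc, pow_succ, mul_assoc (dEl K 1 0 ^ t), d_int, mul_one, ← ee]
      exact mem _ _
  · intro c f hf
    rw [← Algebra.commutes]
    exact Submodule.smul_mem (Fideal K) _ hf
  · intro a b ha hb f hf
    rw [mul_add]
    exact Submodule.add_mem _ (ha f hf) (hb f hf)
  · intro a b ha hb f hf
    rw [← mul_assoc]
    exact hb _ (ha f hf)

lemma Msl_e (s : ℕ) (mu : K) (m : Msl K s mu) : eZ K 1 0 • m = 0 := by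
  obtain ⟨a, rfl⟩ := (MslIdeal K s mu).mkQ_surjective m
  show (MslIdeal K s mu).mkQ (eZ K 1 0 • a) = 0
  refine (Submodule.Quotient.mk_eq_zero _).2 ?_
  refine (le_sup_left : Fideal K ≤ MslIdeal K s mu) ?_
  have : eZ K 1 0 = eEl1 K 0 0 := by simp [eZ, eEl1]
  rw [smul_eq_mul, this]
  exact F_right K a _ (Submodule.subset_span ⟨0, 0, rfl⟩)

/-- spanned by weight vectors, at most one per weight -/
def WS (V : Type*) [AddCommGroup V] [Module K V] [Module (In K 1) V] : Prop :=
  ∃ b : K → V, (∀ c, HEl K 1 0 • b c = c • b c) ∧ Submodule.span K (Set.range b) = ⊤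

lemma WS_of {V : Type*} [AddCommGroup V] [Module K V] [Module (In K 1) V]
    {ι : Type*} (g : ι → K) (hg : Function.Injective g) (b : ι → V)
    (hb : ∀ i, HEl K 1 0 • b i = g i • b i) (hs : Submodule.span K (Set.range b) = ⊤) :
    WS K V := by
  refine ⟨Function.extend g b 0, fun c => ?_, ?_⟩
  · by_cases hc : ∃ i, g i = c
    · obtain ⟨i, rfl⟩ := hc
      rw [hg.extend_apply, hb]
    · rw [Function.extend_apply' _ _ _ hc]; simp
  · rw [eq_top_iff, ← hs]
    apply Submodule.span_mono
    rintro _ ⟨i, rfl⟩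
    exact ⟨g i, hg.extend_apply _ _ _⟩

lemma WS_equiv {V W : Type*} [AddCommGroup V] [Module K V] [Module (In K 1) V]
    [IsScalarTower K (In K 1) V] [AddCommGroup W] [Module K W] [Module (In K 1) W]
    [IsScalarTower K (In K 1) W] (e : V ≃ₗ[In K 1] W) (h : WS K W) : WS K V := by
  obtain ⟨b, hb, hs⟩ := h
  refine ⟨fun c => e.symm (b c), fun c => ?_, ?_⟩
  · rw [← map_smul, hb, ← amap_smul K 1, map_smul, amap_smul]
  · have : (Set.range fun c => e.symm (b c)) = (e.symm.restrictScalars K : W ≃ₗ[K] V) '' Set.range b := by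
      rw [← Set.range_comp]; rfl
    rw [this]
    have h2 := Submodule.map_span ((e.symm.restrictScalars K : W ≃ₗ[K] V) : W →ₗ[K] V) (Set.range b)
    rw [hs, Submodule.map_top, LinearEquiv.range] at h2
    exact h2.symm

lemma WS_cyclic {V : Type*} [AddCommGroup V] [Module K V] [Module (In K 1) V]
    [IsScalarTower K (In K 1) V] (he : ∀ v : V, eZ K 1 0 • v = 0) (u : V) (mu : K)
    (hu : HEl K 1 0 • u = mu • u) (hc : ∀ v : V, ∃ a : In K 1, v = a • u) : WS K V := by
  have hi : ∀ k : ℕ, HEl K 1 0 • (intEl K 1 0 ^ k • u) = (mu + k) • (intEl K 1 0 ^ k • u) := by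
    intro k
    induction k with
    | zero => simp [hu]
    | succ k ih =>
      rw [pow_succ', mul_smul, ← mul_smul (HEl K 1 0), H_int, mul_smul, add_smul (HEl K 1 0), ih,
        one_smul, smul_add, smul_comm (intEl K 1 0), Nat.cast_succ, ← add_assoc,
        add_smul _ (1 : K), one_smul]
  have hd : ∀ k : ℕ, HEl K 1 0 • (dEl K 1 0 ^ k • u) = (mu - k) • (dEl K 1 0 ^ k • u) := by
    intro k
    induction k with
    | zero => simp [hu]
    | succ k ih =>
      have h1 : HEl K 1 0 * dEl K 1 0 = dEl K 1 0 * HEl K 1 0 - dEl K 1 0 := by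
        rw [d_H]; noncomm_ring
      rw [pow_succ', mul_smul, ← mul_smul (HEl K 1 0), h1, sub_smul (dEl K 1 0 * HEl K 1 0),
        mul_smul, ih, smul_comm (dEl K 1 0), Nat.cast_succ, ← sub_sub,
        sub_smul _ (1 : K), one_smul]
  let b : ℤ → V := fun z => match z with
    | Int.ofNat k => intEl K 1 0 ^ k • u
    | Int.negSucc k => dEl K 1 0 ^ (k + 1) • u
  have hbi : ∀ k : ℕ, intEl K 1 0 ^ k • u ∈ Submodule.span K (Set.range b) :=
    fun k => Submodule.subset_span ⟨Int.ofNat k, rfl⟩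
  have hbd : ∀ k : ℕ, dEl K 1 0 ^ k • u ∈ Submodule.span K (Set.range b) := by
    intro k
    cases k with
    | zero => simpa using hbi 0
    | succ k => exact Submodule.subset_span ⟨Int.negSucc k, rfl⟩
  have hb : ∀ z : ℤ, HEl K 1 0 • b z = (mu + (z : K)) • b z := by
    intro z
    rcases z with k | k
    · have := hi k
      simpa [b] using this
    · have := hd (k + 1)
      simp only [b, Int.cast_negSucc]
      rw [this, sub_eq_add_neg]
  refine WS_of K (fun z : ℤ => mu + (z : K)) (fun z w h => by simpa using h) b hb ?_
  rw [eq_top_iff]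
  rintro v -
  have red : ∀ a : In K 1, (∀ z, a • b z ∈ Submodule.span K (Set.range b)) →
      ∀ v ∈ Submodule.span K (Set.range b), a • v ∈ Submodule.span K (Set.range b) := by
    intro a ha v hv
    induction hv using Submodule.span_induction with
    | mem x hx => obtain ⟨z, rfl⟩ := hx; exact ha z
    | zero => rw [smul_zero]; exact Submodule.zero_mem _
    | add x y _ _ hx hy => rw [smul_add]; exact Submodule.add_mem _ hx hy
    | smul r x _ hx => rw [smul_comm]; exact Submodule.smul_mem _ r hx
  have key : ∀ a : In K 1, ∀ v ∈ Submodule.span K (Set.range b),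
      a • v ∈ Submodule.span K (Set.range b) := by
    intro a
    refine In_induction K 1 (p := fun a => ∀ v ∈ Submodule.span K (Set.range b),
      a • v ∈ Submodule.span K (Set.range b)) ?_ ?_ ?_ ?_ ?_ ?_ a
    · intro i
      obtain rfl : i = 0 := Subsingleton.elim _ _
      apply red
      intro z
      rw [hb]
      exact Submodule.smul_mem _ _ (Submodule.subset_span ⟨z, rfl⟩)
    · intro i
      obtain rfl : i = 0 := Subsingleton.elim _ _
      apply red
      rintro (k | k)
      · show dEl K 1 0 • intEl K 1 0 ^ k • u ∈ _
        cases k with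
        | zero => simpa using hbd 1
        | succ k => rw [pow_succ', mul_smul, d_int_smul]; exact hbi k
      · show dEl K 1 0 • dEl K 1 0 ^ (k + 1) • u ∈ _
        rw [← mul_smul, ← pow_succ']
        exact hbd _
    · intro i
      obtain rfl : i = 0 := Subsingleton.elim _ _
      apply red
      rintro (k | k)
      · show intEl K 1 0 • intEl K 1 0 ^ k • u ∈ _
        rw [← mul_smul, ← pow_succ']
        exact hbi _
      · show intEl K 1 0 • dEl K 1 0 ^ (k + 1) • u ∈ _
        rw [pow_succ', mul_smul, int_d_smul K 1 0 _ (he _)]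
        exact hbd _
    · intro c v hv
      rw [amap_smul]
      exact Submodule.smul_mem _ _ hv
    · intro a b ha hb v hv
      rw [add_smul]
      exact Submodule.add_mem _ (ha v hv) (hb v hv)
    · intro a b ha hb v hv
      rw [mul_smul]
      exact ha _ (hb v hv)
  obtain ⟨a, rfl⟩ := hc v
  exact key a u (by simpa using hbi 0)

lemma Msl_WS (mu : K) : WS K (Msl K 1 mu) := by
  refine WS_cyclic K (Msl_e K 1 mu) ((MslIdeal K 1 mu).mkQ 1) mu ?_ ?_
  · have h : (MslIdeal K 1 mu).mkQ ((HEl K 1 0 - algebraMap K (In K 1) mu) • 1) = 0 := by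
      refine (Submodule.Quotient.mk_eq_zero _).2 ?_
      refine (le_sup_right : _ ≤ MslIdeal K 1 mu) ?_
      apply Submodule.subset_span
      simp
    rw [sub_smul, map_sub, map_smul, map_smul, sub_eq_zero] at h
    exact h.trans (amap_smul K 1 (Msl K 1 mu) mu _)
  · intro v
    obtain ⟨a, rfl⟩ := (MslIdeal K 1 mu).mkQ_surjective v
    refine ⟨a, ?_⟩
    have := map_smul (MslIdeal K 1 mu).mkQ a 1
    rw [smul_eq_mul, mul_one] at this
    exact this

lemma P_WS : WS K (P K 1) := by
  refine WS_of K (fun α : Fin 1 →₀ ℕ => ((α 0 : ℕ) : K) + 1) ?_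
    (fun α => MvPolynomial.monomial α 1) (fun α => hEl_monomial K 1 0 α 1) ?_
  · intro α β h
    refine Finsupp.ext fun i => ?_
    obtain rfl : i = 0 := Subsingleton.elim _ _
    simpa using h
  · have := (MvPolynomial.basisMonomials (Fin 1) K).span_eq
    rwa [MvPolynomial.coe_basisMonomials] at this

lemma P_nil (p : P K 1) : ∃ N : ℕ, dEl K 1 0 ^ N • p = 0 := by
  have h1 : ∀ (N : ℕ) (α : Fin 1 →₀ ℕ) (c : K), α 0 < N →
      dEl K 1 0 ^ N • (MvPolynomial.monomial α c : P K 1) = 0 := by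
    intro N
    induction N with
    | zero => intro α c h; omega
    | succ N ih =>
      intro α c h
      rw [pow_succ, mul_smul, d_mon]
      rcases Nat.eq_zero_or_pos (α 0) with h0 | h0
      · simp [h0]
      · apply ih
        simp; omega
  induction p using MvPolynomial.induction_on' with
  | monomial α c => exact ⟨_, h1 (α 0 + 1) α c (Nat.lt_succ_self _)⟩
  | add p q hp hq =>
    obtain ⟨N, hN⟩ := hp
    obtain ⟨N', hN'⟩ := hq
    refine ⟨N + N', ?_⟩
    have a1 : dEl K 1 0 ^ (N + N') • p = 0 := by
      rw [add_comm, pow_add, mul_smul, hN, smul_zero]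
    have a2 : dEl K 1 0 ^ (N + N') • q = 0 := by
      rw [pow_add, mul_smul, hN', smul_zero]
    rw [smul_add, a1, a2, add_zero]

end Aux3


section Aux4
variable (K : Type*) [Field K] [CharZero K] (n : ℕ)

lemma tpm_tprod (Mi : Fin n → ModN K 1) (i : Fin n) (a : In K 1) (f : ∀ j, (Mi j).carrier) :
    tprodMap K n Mi i a (PiTensorProduct.tprod K f) =
      PiTensorProduct.tprod K (Function.update f i (a • f i)) := by
  rw [tprodMap, PiTensorProduct.map_tprod]
  congr 1
  funext j
  by_cases h : j = i
  · subst h; simp only [Function.update_self]; rfl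
  · simp [Function.update_of_ne h]

lemma tpm_mul (Mi : Fin n → ModN K 1) (i : Fin n) (a b : In K 1)
    (w : ⨂[K] j, (Mi j).carrier) :
    tprodMap K n Mi i a (tprodMap K n Mi i b w) = tprodMap K n Mi i (a * b) w := by
  induction w using PiTensorProduct.induction_on with
  | smul_tprod r f =>
    simp only [map_smul, tpm_tprod, Function.update_self, Function.update_idem, mul_smul]
  | add x y hx hy => simp only [map_add, hx, hy]

lemma tpm_id (Mi : Fin n → ModN K 1) (i : Fin n) (a : In K 1)
    (ha : ∀ m : (Mi i).carrier, a • m = m) (w : ⨂[K] j, (Mi j).carrier) :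
    tprodMap K n Mi i a w = w := by
  induction w using PiTensorProduct.induction_on with
  | smul_tprod r f => simp only [map_smul, tpm_tprod, ha, Function.update_eq_self]
  | add x y hx hy => simp only [map_add, hx, hy]

lemma tpm_nil (Mi : Fin n → ModN K 1) (i : Fin n)
    (h : ∀ m : (Mi i).carrier, ∃ N : ℕ, dEl K 1 0 ^ N • m = 0) (w : ⨂[K] j, (Mi j).carrier) :
    ∃ N : ℕ, tprodMap K n Mi i (dEl K 1 0 ^ N) w = 0 := by
  induction w using PiTensorProduct.induction_on with
  | smul_tprod r f =>
    obtain ⟨N, hN⟩ := h (f i)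
    refine ⟨N, ?_⟩
    rw [map_smul, tpm_tprod, hN, MultilinearMap.map_coord_zero _ i (Function.update_self _ _ _),
      smul_zero]
  | add x y hx hy =>
    obtain ⟨N, hN⟩ := hx
    obtain ⟨N', hN'⟩ := hy
    refine ⟨N + N', ?_⟩
    have a1 : tprodMap K n Mi i (dEl K 1 0 ^ (N + N')) x = 0 := by
      rw [add_comm, pow_add, ← tpm_mul, hN, map_zero]
    have a2 : tprodMap K n Mi i (dEl K 1 0 ^ (N + N')) y = 0 := by
      rw [pow_add, ← tpm_mul, hN', map_zero]
    rw [map_add, a1, a2, add_zero]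

variable {V : Type*} [AddCommGroup V] [Module K V] [Module (In K n) V]
  [IsScalarTower K (In K n) V]

lemma MD_a {lam : Fin n → K} {D : Set (Fin n)} (h : RealizesMD K n lam D V) (i : Fin n)
    (hi : i ∉ D) (v : V) : eZ K n i • v = 0 := by
  obtain ⟨Mi, hP, hM, φ, hφ⟩ := h
  obtain ⟨e⟩ := hM i hi
  have h1 : intEl K n i • dEl K n i • v = v := by
    apply φ.injective
    rw [(hφ i _).2.2, (hφ i _).2.1, tpm_mul]
    apply tpm_id
    intro m
    rw [mul_smul]
    apply int_d_smul K 1 0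
    apply e.injective
    rw [map_smul, Msl_e, map_zero]
  rw [eZ, sub_smul, one_smul, mul_smul, h1, sub_self]

lemma MD_b {lam : Fin n → K} {D : Set (Fin n)} (h : RealizesMD K n lam D V) (i : Fin n)
    (hi : i ∈ D) (v : V) : ∃ N : ℕ, dEl K n i ^ N • v = 0 := by
  obtain ⟨Mi, hP, hM, φ, hφ⟩ := h
  obtain ⟨e⟩ := hP i hi
  have h1 : ∀ N : ℕ, φ (dEl K n i ^ N • v) = tprodMap K n Mi i (dEl K 1 0 ^ N) (φ v) := by
    intro N
    induction N with
    | zero =>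
      rw [pow_zero, one_smul, pow_zero, tpm_id]
      intro m; rw [one_smul]
    | succ N ih =>
      rw [pow_succ', mul_smul, (hφ i _).2.1, ih, tpm_mul, ← pow_succ']
  obtain ⟨N, hN⟩ := tpm_nil K n Mi i (fun m => by
    obtain ⟨N, hN⟩ := P_nil K (e m)
    refine ⟨N, e.injective ?_⟩
    rw [map_smul, hN, map_zero]) (φ v)
  refine ⟨N, φ.injective ?_⟩
  rw [h1, hN, map_zero]

lemma MD_c {lam : Fin n → K} {D : Set (Fin n)} (h : RealizesMD K n lam D V) (mu : Fin n → K) :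
    ∃ v : V, genWeightSpace K n V mu ≤ Submodule.span K {v} := by
  obtain ⟨Mi, hP, hM, φ, hφ⟩ := h
  have hW : ∀ i, WS K (Mi i).carrier := by
    intro i
    by_cases hi : i ∈ D
    · obtain ⟨e⟩ := hP i hi
      exact WS_equiv K e (P_WS K)
    · obtain ⟨e⟩ := hM i hi
      exact WS_equiv K e (Msl_WS K _)
  choose b hb hs using hW
  let B : (Fin n → K) → V := fun mu => φ.symm (PiTensorProduct.tprod K fun j => b j (mu j))
  refine ⟨B mu, ?_⟩
  refine exists_sum K n (F := fun mu => Submodule.span K {B mu}) ?_ ?_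
  · intro nu
    refine le_trans ?_ (weight_le_gen K n V nu)
    rw [Submodule.span_singleton_le_iff_mem]
    intro i
    apply φ.injective
    rw [HEl, mul_smul, (hφ i _).2.1, (hφ i _).1, tpm_mul, map_smul]
    simp only [B, LinearEquiv.apply_symm_apply]
    rw [tpm_tprod, ← HEl, hb, MultilinearMap.map_update_smul, Function.update_eq_self]
  · have := PiTensorProduct.submodule_span_eq_top (R := K) (g := fun i => b i) hs
    rw [← Submodule.span_range_eq_iSup]
    have h2 : Set.range B = (φ.symm : _ ≃ₗ[K] V) ''
        Set.range (fun mu : Fin n → K => PiTensorProduct.tprod K fun j => b j (mu j)) := by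
      rw [← Set.range_comp]; rfl
    rw [h2]
    have h3 := Submodule.map_span (φ.symm : _ →ₗ[K] V)
      (Set.range (fun mu : Fin n → K => PiTensorProduct.tprod K fun j => b j (mu j)))
    rw [this, Submodule.map_top, LinearEquiv.range] at h3
    exact h3.symm

end Aux4


section Aux5
variable (K : Type*) [Field K] [CharZero K] (n : ℕ)
variable {M : Type*} [AddCommGroup M] [Module K M] [Module (In K n) M]
  [IsScalarTower K (In K n) M]

lemma exists_simple {R : Type*} [Ring R] {M : Type*} [AddCommGroup M] [Module R M] (m : M)
    (hm : m ≠ 0) : ∃ p q : Submodule R M, p ≤ q ∧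
      IsSimpleModule R (q ⧸ Submodule.comap q.subtype p) ∧ m ∈ q ∧ m ∉ p := by
  let q := Submodule.span R {m}
  have hmq : m ∈ q := Submodule.mem_span_singleton_self m
  obtain h | ⟨N, hN, -⟩ := (IsCoatomic.eq_top_or_exists_le_coatom (⊥ : Submodule R q))
  · exfalso
    have : (⟨m, hmq⟩ : q) ∈ (⊥ : Submodule R q) := h ▸ Submodule.mem_top
    rw [Submodule.mem_bot] at this
    exact hm (congrArg Subtype.val this)
  · have hc : Submodule.comap q.subtype (N.map q.subtype) = N :=
      Submodule.comap_map_eq_of_injective q.injective_subtype N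
    refine ⟨N.map q.subtype, q, Submodule.map_subtype_le _ _, ?_, hmq, fun h => ?_⟩
    · rw [hc]
      exact isSimpleModule_iff_isCoatom.2 hN
    · apply hN.1
      have h1 : (⟨m, hmq⟩ : q) ∈ N := by
        rw [← hc]; exact h
      rw [eq_top_iff]
      rintro ⟨x, hx⟩ -
      obtain ⟨a, rfl⟩ := Submodule.mem_span_singleton.1 hx
      exact N.smul_mem a h1

lemma sub_mem (q : Submodule (In K n) M) {lam : Fin n → K} {m : M}
    (hm : m ∈ genWeightSpace K n M lam) (hq : m ∈ q) :
    (⟨m, hq⟩ : q) ∈ genWeightSpace K n q lam := by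
  obtain ⟨N, hN⟩ := hm
  exact ⟨N, fun j => Subtype.ext (hN j)⟩

lemma d_pow_ne (i : Fin n) (N : ℕ) : ∀ (lam : Fin n → K) (v : M), (∀ k : ℕ, lam i ≠ (k : K) + 1) →
    v ∈ genWeightSpace K n M lam → v ≠ 0 → dEl K n i ^ N • v ≠ 0 := by
  induction N with
  | zero => intro lam v _ _ h; simpa using h
  | succ N ih =>
    intro lam v hl hv h0
    rw [pow_succ, mul_smul]
    refine ih _ _ ?_ (d_mem K n i hv) ?_
    · intro k hk
      rw [Function.update_self] at hk
      apply hl (k + 1)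
      push_cast
      linear_combination hk
    · intro h
      have := int_d_smul K n i v (e_zero K n i hv (by simpa using hl 0))
      rw [h, smul_zero] at this
      exact h0 this.symm

lemma good_of {lam : Fin n → K} {D : Set (Fin n)} (h : InGWD K n lam D M) : Good K n M := by
  intro i
  by_cases hi : i ∈ D
  · right
    intro mu hmu
    by_contra hk
    push Not at hk
    obtain ⟨m, hm, hm0⟩ := (Submodule.ne_bot_iff _).1 hmu
    obtain ⟨p, q, hpq, hs, hmq, hmp⟩ := exists_simple (R := In K n) m hm0
    have hr := h.2.2 p q hpq hs
    have h1 := mk_mem K n (Submodule.comap q.subtype p) (sub_mem K n q hm hmq)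
    obtain ⟨N, hN⟩ := MD_b K n hr i hi ((Submodule.comap q.subtype p).mkQ ⟨m, hmq⟩)
    refine d_pow_ne K n i N mu _ hk h1 ?_ hN
    intro h0
    exact hmp ((Submodule.Quotient.mk_eq_zero (Submodule.comap q.subtype p)).1 h0)
  · left
    intro m
    by_contra hm0
    obtain ⟨p, q, hpq, hs, hmq, hmp⟩ := exists_simple (R := In K n) _ hm0
    have hr := h.2.2 p q hpq hs
    have h1 := MD_a K n hr i hi ((Submodule.comap q.subtype p).mkQ ⟨_, hmq⟩)
    rw [← map_smul] at h1
    have h2 := (Submodule.Quotient.mk_eq_zero _).1 h1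
    apply hmp
    have h3 : eZ K n i • eZ K n i • m ∈ p := h2
    rwa [← mul_smul, eZ_eZ] at h3

lemma orb_of {lam : Fin n → K} {D : Set (Fin n)} (h : InGWD K n lam D M) :
    ∀ mu ∈ supp K n M, ∀ nu ∈ supp K n M, ∀ i, ∃ z : ℤ, mu i - nu i = (z : K) := by
  intro mu hmu nu hnu i
  obtain ⟨a, ha⟩ := h.2.1 hmu i
  obtain ⟨b, hb⟩ := h.2.1 hnu i
  exact ⟨a - b, by push_cast; linear_combination ha - hb⟩

/-- the weight component of a submodule -/
noncomputable def comp (mu : Fin n → K) (p : Submodule (In K n) M) : Submodule K M :=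
  genWeightSpace K n M mu ⊓ p.restrictScalars K

lemma comp_rank {lam : Fin n → K} {D : Set (Fin n)} (h : InGWD K n lam D M)
    {p q : Submodule (In K n) M} (hpq : p ⋖ q) {mu : Fin n → K} (hmu : mu ∈ supp K n M) :
    Module.rank K (comp K n mu q) = Module.rank K (comp K n mu p) + 1 := by
  have hs := (covBy_iff_quot_is_simple hpq.le).1 hpq
  have hr := h.2.2 p q hpq.le hs
  obtain ⟨v, hv⟩ := MD_c K n hr mu
  let g : comp K n mu q →ₗ[K] (q ⧸ Submodule.comap q.subtype p) :=
    ((Submodule.comap q.subtype p).mkQ.restrictScalars K).comp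
      (Submodule.inclusion (inf_le_right : comp K n mu q ≤ q.restrictScalars K))
  have hle : comp K n mu p ≤ comp K n mu q := inf_le_inf_left _ hpq.le
  have hg : ∀ x : comp K n mu q, g x = (Submodule.comap q.subtype p).mkQ ⟨x.1, x.2.2⟩ := fun x => rfl
  have hker : LinearMap.ker g = (comp K n mu p).comap (comp K n mu q).subtype := by
    ext x
    rw [LinearMap.mem_ker, hg, Submodule.mkQ_apply, Submodule.Quotient.mk_eq_zero]
    constructor
    · intro hx; exact ⟨x.2.1, hx⟩
    · intro hx; exact hx.2
  have h1 := LinearMap.rank_range_add_rank_ker g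
  have h2 : Module.rank K (LinearMap.ker g) = Module.rank K (comp K n mu p) := by
    rw [hker]
    exact (Submodule.comapSubtypeEquivOfLe hle).rank_eq
  have h3 : Module.rank K (LinearMap.range g) = 1 := by
    have hsp : LinearMap.range g ≤ Submodule.span K {v} := by
      refine le_trans ?_ hv
      rintro _ ⟨x, rfl⟩
      rw [hg]
      exact mk_mem K n _ (sub_mem K n q x.2.1 x.2.2)
    apply le_antisymm
    · exact (Submodule.rank_mono hsp).trans (rank_span_le _ |>.trans (by simp))
    · rw [Cardinal.one_le_iff_ne_zero, Ne, Submodule.rank_eq_zero]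
      obtain ⟨m, hm, hmq, hmp⟩ := good_strict K n (gw_iSup K n h.1) (good_of K n h)
        (orb_of K n h) hpq.lt hmu
      intro hb
      have : g ⟨m, hm, hmq⟩ ∈ LinearMap.range g := ⟨_, rfl⟩
      rw [hb, Submodule.mem_bot, hg, Submodule.mkQ_apply, Submodule.Quotient.mk_eq_zero] at this
      exact hmp this
  rw [← h1, h2, h3, add_comm]

lemma series_rank {lam : Fin n → K} {D : Set (Fin n)} (h : InGWD K n lam D M)
    {mu : Fin n → K} (hmu : mu ∈ supp K n M) (s : CompositionSeries (Submodule (In K n) M))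
    (h0 : s.head = ⊥) (h1 : s.last = ⊤) :
    (s.length : Cardinal) = Module.rank K (genWeightSpace K n M mu) := by
  have key : ∀ (k : ℕ) (hk : k < s.length + 1),
      Module.rank K (comp K n mu (s ⟨k, hk⟩)) = (k : Cardinal) := by
    intro k
    induction k with
    | zero =>
      intro hk
      have : s ⟨0, hk⟩ = ⊥ := h0
      rw [this]
      have hb : comp K n mu (⊥ : Submodule (In K n) M) = ⊥ := by
        rw [eq_bot_iff]; intro x hx; exact hx.2
      rw [hb]; simp
    | succ k ih =>
      intro hk
      have hst : s ⟨k, by omega⟩ ⋖ s ⟨k + 1, hk⟩ := s.step ⟨k, by omega⟩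
      rw [comp_rank K n h hst hmu, ih]
      push_cast; rfl
  have hl := key s.length (Nat.lt_succ_self _)
  have : s ⟨s.length, Nat.lt_succ_self _⟩ = ⊤ := h1
  rw [this] at hl
  have ht : comp K n mu (⊤ : Submodule (In K n) M) = genWeightSpace K n M mu := by
    rw [comp, Submodule.restrictScalars_top, inf_top_eq]
  rw [ht] at hl
  exact hl.symm

lemma series_exists {lam : Fin n → K} {D : Set (Fin n)} (h : InGWD K n lam D M)
    {mu : Fin n → K} (hmu : mu ∈ supp K n M) (hf : FiniteDimensional K (genWeightSpace K n M mu)) :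
    ∃ s : CompositionSeries (Submodule (In K n) M), s.head = ⊥ ∧ s.last = ⊤ ∧
      s.length = Module.finrank K (genWeightSpace K n M mu) := by
  have hfin : ∀ p : Submodule (In K n) M, FiniteDimensional K (comp K n mu p) := fun p =>
    Submodule.finiteDimensional_of_le (inf_le_left : comp K n mu p ≤ genWeightSpace K n M mu)
  have hmono : StrictMono (comp K n mu (M := M)) := by
    intro p q hpq
    obtain ⟨m, hm, hmq, hmp⟩ := good_strict K n (gw_iSup K n h.1) (good_of K n h)
        (orb_of K n h) hpq hmu
    refine lt_of_le_of_ne (inf_le_inf_left _ hpq.le) fun he => hmp ?_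
    have : m ∈ comp K n mu q := ⟨hm, hmq⟩
    rw [← he] at this
    exact this.2
  let f : Submodule (In K n) M → ℕ := fun p => Module.finrank K (comp K n mu p)
  have hfm : StrictMono f := fun p q hpq => Submodule.finrank_lt_finrank_of_lt (hmono hpq)
  have hbd : ∀ p, f p ≤ Module.finrank K (genWeightSpace K n M mu) := fun p =>
    Submodule.finrank_mono (inf_le_left : comp K n mu p ≤ genWeightSpace K n M mu)
  have hA : IsArtinian (In K n) M := ⟨hfm.wellFoundedLT.wf⟩
  have hN : IsNoetherian (In K n) M := by
    rw [isNoetherian_iff']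
    let g : Submodule (In K n) M → ℕ := fun p => Module.finrank K (genWeightSpace K n M mu) - f p
    have hg : StrictAnti g := by
      intro p q hpq
      have a := hfm hpq
      have b := hbd p
      have c := hbd q
      simp only [g]; omega
    exact hg.wellFoundedGT
  obtain ⟨s, h0, h1⟩ := exists_compositionSeries_of_isNoetherian_isArtinian (In K n) M
  refine ⟨s, h0, h1, ?_⟩
  have := series_rank K n h hmu s h0 h1
  rw [← Module.finrank_eq_rank] at this
  exact_mod_cast this

end Aux5


section Aux6
variable (K : Type*) [Field K] [CharZero K] (n : ℕ)
variable {M : Type*} [AddCommGroup M] [Module K M] [Module (In K n) M]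
  [IsScalarTower K (In K n) M]

lemma mkSub (S : Submodule K M) (hH : ∀ i, ∀ m ∈ S, HEl K n i • m ∈ S)
    (hd : ∀ i, ∀ m ∈ S, dEl K n i • m ∈ S) (hi : ∀ i, ∀ m ∈ S, intEl K n i • m ∈ S) :
    ∃ p : Submodule (In K n) M, ∀ m, m ∈ p ↔ m ∈ S := by
  refine ⟨⟨S.toAddSubmonoid, ?_⟩, fun m => Iff.rfl⟩
  intro a
  refine In_induction K n (p := fun a => ∀ {m : M}, m ∈ S → a • m ∈ S) ?_ ?_ ?_ ?_ ?_ ?_ a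
  · intro i m hm; exact hH i m hm
  · intro i m hm; exact hd i m hm
  · intro i m hm; exact hi i m hm
  · intro c m hm; rw [amap_smul]; exact S.smul_mem c hm
  · intro a b ha hb m hm; rw [add_smul]; exact S.add_mem (ha hm) (hb hm)
  · intro a b ha hb m hm; rw [mul_smul]; exact ha (hb hm)

lemma orbSub (T : Set (Fin n → K))
    (h1 : ∀ lam ∈ T, ∀ i, Function.update lam i (lam i - 1) ∈ T)
    (h2 : ∀ lam ∈ T, ∀ i, Function.update lam i (lam i + 1) ∈ T) :
    ∃ p : Submodule (In K n) M, ∀ m, m ∈ p ↔ m ∈ ⨆ lam ∈ T, genWeightSpace K n M lam := by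
  have red : ∀ a : In K n, (∀ lam ∈ T, ∀ m ∈ genWeightSpace K n M lam,
      ∃ mu ∈ T, a • m ∈ genWeightSpace K n M mu) →
      ∀ m ∈ ⨆ lam ∈ T, genWeightSpace K n M lam, a • m ∈ ⨆ lam ∈ T, genWeightSpace K n M lam := by
    intro a ha
    have : (⨆ lam ∈ T, genWeightSpace K n M lam) ≤
        (⨆ lam ∈ T, genWeightSpace K n M lam).comap (DistribSMul.toLinearMap K M a) := by
      refine iSup₂_le fun lam hlam m hm => ?_
      obtain ⟨mu, hmu, hm'⟩ := ha lam hlam m hm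
      exact Submodule.mem_iSup_of_mem mu (Submodule.mem_iSup_of_mem hmu hm')
    exact fun m hm => this hm
  exact mkSub K n _ (fun i => red _ fun lam hl m hm => ⟨lam, hl, H_mem K n i hm⟩)
    (fun i => red _ fun lam hl m hm => ⟨_, h1 lam hl i, d_mem K n i hm⟩)
    (fun i => red _ fun lam hl m hm => ⟨_, h2 lam hl i, int_mem K n i hm⟩)

lemma one_orbit (h : IsGenWeightModule K n M) (hin : IsIndecomposableMod K n M) :
    ∀ mu ∈ supp K n M, ∀ nu ∈ supp K n M, ∀ i, ∃ z : ℤ, mu i - nu i = (z : K) := by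
  intro mu hmu nu hnu
  let T : Set (Fin n → K) := {a | ∀ i, ∃ z : ℤ, mu i - a i = (z : K)}
  have hT : ∀ (lam : Fin n → K) (i : Fin n) (e : ℤ),
      Function.update lam i (lam i + (e : K)) ∈ T ↔ lam ∈ T := by
    intro lam i e
    constructor
    · intro hl j
      obtain ⟨z, hz⟩ := hl j
      by_cases hj : j = i
      · subst hj
        rw [Function.update_self] at hz
        exact ⟨z + e, by push_cast; linear_combination hz⟩
      · rw [Function.update_of_ne hj] at hz
        exact ⟨z, hz⟩
    · intro hl j
      obtain ⟨z, hz⟩ := hl j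
      by_cases hj : j = i
      · subst hj
        rw [Function.update_self]
        exact ⟨z - e, by push_cast; linear_combination hz⟩
      · rw [Function.update_of_ne hj]
        exact ⟨z, hz⟩
  have hm1 : ∀ (lam : Fin n → K) (i : Fin n), Function.update lam i (lam i - 1) ∈ T ↔ lam ∈ T := by
    intro lam i
    have := hT lam i (-1)
    push_cast at this
    rwa [← sub_eq_add_neg] at this
  have hp1 : ∀ (lam : Fin n → K) (i : Fin n), Function.update lam i (lam i + 1) ∈ T ↔ lam ∈ T := by
    intro lam i
    have := hT lam i 1
    push_cast at this
    exact this
  obtain ⟨p, hp⟩ := orbSub K n (M := M) T (fun lam hl i => (hm1 lam i).2 hl)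
    (fun lam hl i => (hp1 lam i).2 hl)
  obtain ⟨q, hq⟩ := orbSub K n (M := M) Tᶜ (fun lam hl i h => hl ((hm1 lam i).1 h))
    (fun lam hl i h => hl ((hp1 lam i).1 h))
  have hdis : Disjoint (⨆ lam ∈ T, genWeightSpace K n M lam)
      (⨆ lam ∈ Tᶜ, genWeightSpace K n M lam) :=
    (genWS_indep K n M).disjoint_biSup_biSup disjoint_compl_right
  have hcompl : IsCompl p q := by
    constructor
    · rw [Submodule.disjoint_def]
      intro x hx hx'
      exact Submodule.disjoint_def.1 hdis x ((hp x).1 hx) ((hq x).1 hx')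
    · rw [codisjoint_iff, eq_top_iff]
      rintro x -
      have hle : (⨆ lam, genWeightSpace K n M lam) ≤ (p ⊔ q).restrictScalars K := by
        refine iSup_le fun lam m hm => ?_
        by_cases hl : lam ∈ T
        · exact (le_sup_left : p ≤ p ⊔ q)
            ((hp m).2 (Submodule.mem_iSup_of_mem lam (Submodule.mem_iSup_of_mem hl hm)))
        · exact (le_sup_right : q ≤ p ⊔ q)
            ((hq m).2 (Submodule.mem_iSup_of_mem lam (Submodule.mem_iSup_of_mem hl hm)))
      rw [gw_iSup K n h] at hle
      exact hle Submodule.mem_top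
  by_contra hnT
  obtain ⟨m, hm, hm0⟩ := (Submodule.ne_bot_iff _).1 hmu
  obtain ⟨m', hm', hm0'⟩ := (Submodule.ne_bot_iff _).1 hnu
  rcases hin.2 p q hcompl with hb | hb
  · apply hm0
    have : m ∈ p := (hp m).2 (Submodule.mem_iSup_of_mem mu
      (Submodule.mem_iSup_of_mem (fun i => ⟨0, by simp⟩) hm))
    rwa [hb, Submodule.mem_bot] at this
  · apply hm0'
    have : m' ∈ q := (hq m').2 (Submodule.mem_iSup_of_mem nu
      (Submodule.mem_iSup_of_mem hnT hm'))
    rwa [hb, Submodule.mem_bot] at this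

lemma e_comm {i : Fin n} {a : In K n} (h1 : Commute (dEl K n i) a) (h2 : Commute (intEl K n i) a) :
    Commute (eZ K n i) a :=
  (Commute.one_left a).sub_left (h2.mul_left h1)

lemma sub_nil (i : Fin n) : ∃ p : Submodule (In K n) M, ∀ m, m ∈ p ↔ ∃ N : ℕ, dEl K n i ^ N • m = 0 := by
  let S : Submodule K M :=
    { carrier := {m | ∃ N : ℕ, dEl K n i ^ N • m = 0}
      add_mem' := by
        rintro a b ⟨N, hN⟩ ⟨N', hN'⟩
        refine ⟨N + N', ?_⟩
        have a1 : dEl K n i ^ (N + N') • a = 0 := by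
          rw [add_comm, pow_add, mul_smul, hN, smul_zero]
        have a2 : dEl K n i ^ (N + N') • b = 0 := by
          rw [pow_add, mul_smul, hN', smul_zero]
        rw [smul_add, a1, a2, add_zero]
      zero_mem' := ⟨0, smul_zero _⟩
      smul_mem' := by
        rintro c m ⟨N, hN⟩
        exact ⟨N, by rw [← smul_comm c _ m, hN, smul_zero]⟩ }
  have hcom : ∀ a : In K n, Commute (dEl K n i) a → ∀ m ∈ S, a • m ∈ S := by
    rintro a ha m ⟨N, hN⟩
    refine ⟨N, ?_⟩
    rw [← mul_smul, (ha.pow_left N).eq, mul_smul, hN, smul_zero]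
  refine mkSub K n S ?_ ?_ ?_
  · intro j
    by_cases hj : i = j
    · subst hj
      rintro m ⟨N, hN⟩
      refine ⟨N, ?_⟩
      rw [← mul_smul, d_pow_H, mul_smul, hN, smul_zero]
    · exact hcom _ (d_H_ne K n hj)
  · intro j
    exact hcom _ (d_d K n i j)
  · intro j
    by_cases hj : i = j
    · subst hj
      rintro m ⟨N, hN⟩
      refine ⟨N + 1, ?_⟩
      rw [pow_succ, mul_smul, d_int_smul, hN]
    · exact hcom _ (d_int_ne K n hj)

lemma sub_inv (i : Fin n) : ∃ p : Submodule (In K n) M, ∀ m, m ∈ p ↔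
    ∀ k : ℕ, eZ K n i • dEl K n i ^ k • m = 0 := by
  let S : Submodule K M :=
    { carrier := {m | ∀ k : ℕ, eZ K n i • dEl K n i ^ k • m = 0}
      add_mem' := by
        intro a b ha hb k
        rw [smul_add, smul_add, ha k, hb k, add_zero]
      zero_mem' := by intro k; rw [smul_zero, smul_zero]
      smul_mem' := by
        intro c m hm k
        rw [← smul_comm c _ m, ← smul_comm c _ _, hm k, smul_zero] }
  have hcom : ∀ a : In K n, Commute (dEl K n i) a → Commute (intEl K n i) a →
      ∀ m ∈ S, a • m ∈ S := by
    intro a ha hb m hm k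
    rw [← mul_smul _ a, (ha.pow_left k).eq, mul_smul, ← mul_smul, (e_comm K n ha hb).eq, mul_smul,
      hm k, smul_zero]
  refine mkSub K n S ?_ ?_ ?_
  · intro j
    by_cases hj : i = j
    · subst hj
      intro m hm k
      rw [← mul_smul _ (HEl K n i), d_pow_H, mul_smul, ← mul_smul, mul_add, eZ_H,
        ← (Nat.cast_commute k _).eq, add_smul, mul_smul, hm k, smul_zero, add_zero]
    · exact hcom _ (d_H_ne K n hj) (int_H_ne K n hj)
  · intro j
    by_cases hj : i = j
    · subst hj
      intro m hm k
      rw [← mul_smul _ (dEl K n i), ← pow_succ]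
      exact hm _
    · exact hcom _ (d_d K n i j) (d_int_ne K n (Ne.symm hj)).symm
  · intro j
    by_cases hj : i = j
    · subst hj
      intro m hm k
      cases k with
      | zero => rw [pow_zero, one_smul, ← mul_smul, eZ_int, zero_smul]
      | succ k => rw [pow_succ, mul_smul _ (dEl K n i), d_int_smul]; exact hm k
    · exact hcom _ (d_int_ne K n hj) (int_int K n i j)

lemma e_zero_pow (i : Fin n) (N : ℕ) : ∀ (lam : Fin n → K) (v : M), (∀ k : ℕ, lam i ≠ (k : K) + 1) →
    v ∈ genWeightSpace K n M lam → eZ K n i • dEl K n i ^ N • v = 0 := by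
  induction N with
  | zero =>
    intro lam v hl hv
    rw [pow_zero, one_smul]
    exact e_zero K n i hv (by simpa using hl 0)
  | succ N ih =>
    intro lam v hl hv
    rw [pow_succ, mul_smul (dEl K n i ^ N)]
    refine ih _ _ ?_ (d_mem K n i hv)
    intro k hk
    rw [Function.update_self] at hk
    apply hl (k + 1)
    push_cast
    linear_combination hk

lemma good_indec (h : IsGenWeightModule K n M) (hin : IsIndecomposableMod K n M) : Good K n M := by
  intro i
  obtain ⟨p, hp⟩ := sub_nil K n (M := M) i
  obtain ⟨q, hq⟩ := sub_inv K n (M := M) i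
  have hc : IsCompl p q := by
    constructor
    · rw [Submodule.disjoint_def]
      intro x hx hx'
      obtain ⟨N, hN⟩ := (hp x).1 hx
      have hx' := (hq x).1 hx'
      induction N with
      | zero => simpa using hN
      | succ N ih =>
        apply ih
        have := int_d_smul K n i _ (hx' N)
        rw [← mul_smul (dEl K n i), ← pow_succ', hN, smul_zero] at this
        exact this.symm
    · rw [codisjoint_iff, eq_top_iff]
      rintro x -
      have hz : ∀ lam : Fin n → K, (∀ k : ℕ, lam i ≠ (k : K) + 1) →
          ∀ m ∈ genWeightSpace K n M lam, m ∈ p ⊔ q := fun lam hl m hm =>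
        (le_sup_right : q ≤ p ⊔ q) ((hq m).2 fun k => e_zero_pow K n i k lam m hl hm)
      have hs : ∀ m : M, dEl K n i • m ∈ p ⊔ q → m ∈ p ⊔ q := by
        intro m hm
        have e1 : m = intEl K n i • dEl K n i • m + eZ K n i • m := by
          rw [eZ, sub_smul, one_smul, mul_smul]; abel
        rw [e1]
        refine Submodule.add_mem _ (Submodule.smul_mem _ _ hm) ((le_sup_left : p ≤ p ⊔ q) ?_)
        exact (hp _).2 ⟨1, by rw [pow_one, ← mul_smul, d_eZ, zero_smul]⟩
      have hk : ∀ (k : ℕ) (lam : Fin n → K), lam i = (k : K) + 1 →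
          ∀ m ∈ genWeightSpace K n M lam, m ∈ p ⊔ q := by
        intro k
        induction k with
        | zero =>
          intro lam hl m hm
          refine hs m (hz _ ?_ _ (d_mem K n i hm))
          intro k hk
          rw [Function.update_self, hl] at hk
          apply natne K k
          rw [← hk]; simp
        | succ k ih =>
          intro lam hl m hm
          refine hs m (ih _ ?_ _ (d_mem K n i hm))
          rw [Function.update_self, hl]
          push_cast; ring
      have hle : (⨆ lam, genWeightSpace K n M lam) ≤ (p ⊔ q).restrictScalars K := by
        refine iSup_le fun lam m hm => ?_
        by_cases hl : ∃ k : ℕ, lam i = (k : K) + 1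
        · obtain ⟨k, hl⟩ := hl
          exact hk k lam hl m hm
        · push Not at hl
          exact hz lam hl m hm
      rw [gw_iSup K n h] at hle
      exact hle Submodule.mem_top
  rcases hin.2 p q hc with hb | hb
  · left
    intro m
    have : eZ K n i • m ∈ p := (hp _).2 ⟨1, by rw [pow_one, ← mul_smul, d_eZ, zero_smul]⟩
    rwa [hb, Submodule.mem_bot] at this
  · right
    intro lam hlam
    by_contra hl
    push Not at hl
    obtain ⟨m, hm, hm0⟩ := (Submodule.ne_bot_iff _).1 hlam
    have : m ∈ q := (hq m).2 fun k => e_zero_pow K n i k lam m hl hm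
    rw [hb, Submodule.mem_bot] at this
    exact hm0 this

end Aux6

/-- all modules in `GW(𝕀_n, 𝒟_Ω)` (and all weight modules therein) are
equidimensional, with length equal to the dimension of any (generalized) weight component;
in particular every indecomposable generalized weight `𝕀_n`-module is equidimensional. -/
theorem statement16 (K : Type*) [Field K] [CharZero K] (n : ℕ)
    (lam : Fin n → K) (hnorm : IsNormalized K n lam)
    (D : Set (Fin n)) (hD : D ⊆ DD K n lam) :
    (∀ (M : Type*) [AddCommGroup M] [Module K M] [Module (In K n) M] [IsScalarTower K (In K n) M], InGWD K n lam D M →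
      (∀ mu ∈ supp K n M, ∀ nu ∈ supp K n M,
        Module.rank K (genWeightSpace K n M mu) = Module.rank K (genWeightSpace K n M nu)) ∧
      (IsWeightModule K n M → ∀ mu ∈ supp K n M,
        Module.rank K (weightSpace K n M mu) = Module.rank K (genWeightSpace K n M mu)) ∧
      (∀ mu ∈ supp K n M, ∀ s : CompositionSeries (Submodule (In K n) M),
        s.head = ⊥ → s.last = ⊤ →
        (s.length : Cardinal) = Module.rank K (genWeightSpace K n M mu)) ∧
      (∀ mu ∈ supp K n M, FiniteDimensional K (genWeightSpace K n M mu) →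
        ∃ s : CompositionSeries (Submodule (In K n) M),
          s.head = ⊥ ∧ s.last = ⊤ ∧ s.length = Module.finrank K (genWeightSpace K n M mu))) ∧
    (∀ (M : Type*) [AddCommGroup M] [Module K M] [Module (In K n) M] [IsScalarTower K (In K n) M],
      IsGenWeightModule K n M → IsIndecomposableMod K n M →
      ∀ mu ∈ supp K n M, ∀ nu ∈ supp K n M,
        Module.rank K (genWeightSpace K n M mu) = Module.rank K (genWeightSpace K n M nu)) := by
  refine ⟨?_, ?_⟩
  · intro M _ _ _ _ h
    refine ⟨?_, ?_, ?_, ?_⟩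
    · intro mu hmu nu hnu
      exact rank_good K n (good_of K n h) hmu hnu (orb_of K n h mu hmu nu hnu)
    · intro hw mu _
      rw [weight_eq_gen K n hw mu]
    · intro mu hmu s h0 h1
      exact series_rank K n h hmu s h0 h1
    · intro mu hmu hf
      exact series_exists K n h hmu hf
  · intro M _ _ _ _ h hin mu hmu nu hnu
    exact rank_good K n (good_indec K n h hin) hmu hnu (one_orbit K n h hin mu hmu nu hnu)

end IDO
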